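/- Let d ≥ 1 and ρ ∈ (0,2). Let V : ℝ^d → ℝ be of class C¹ and assume there exist constants C, R ∈ (0,∞) such that |V(x)| ≤ C(1+|x|)^{-ρ} and |∇V(x)| ≤ C(1+|x|)^{-ρ-1} for all x ∈ ℝ^d, and that there is a constant C' > 0 with V(x) ≤ -C'|x|^{-ρ} for all |x| ≥ R. Then N(E;V) / N_cl(E;V) → 1 as E ↑ 0, and there exist constants c₁, c₂ ∈ (0,∞) and E₀ < 0 such that c₁|E|^{d(1/2 - 1/ρ)} ≤ N(E;V) ≤ c₂|E|^{d(1/2 - 1/ρ)} for all E ∈ (E₀, 0). -/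

import Mathlib

open MeasureTheory Filter Real Set Topology

noncomputable section

abbrev Ed (d : ℕ) := EuclideanSpace ℝ (Fin d)

/-- Glazman variational count of eigenvalues of `-Δ + V` below `E`. -/
noncomputable def schN (d : ℕ) (V : Ed d → ℝ) (E : ℝ) : ℕ∞ :=
  ⨆ F : {F : Submodule ℝ (Ed d → ℝ) //
      (∀ u ∈ F, ContDiff ℝ (⊤ : ℕ∞) u ∧ HasCompactSupport u) ∧
      (∀ u ∈ F, u ≠ 0 →
        (∫ x, (‖gradient u x‖ ^ 2 + V x * u x ^ 2)) < E * ∫ x, u x ^ 2)},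
    (Module.finrank ℝ F.1 : ℕ∞)

/-- Laplacian. -/
noncomputable def lap (d : ℕ) (φ : Ed d → ℝ) (x : Ed d) : ℝ :=
  ∑ i : Fin d, iteratedFDeriv ℝ 2 φ x ![EuclideanSpace.single i 1, EuclideanSpace.single i 1]

/-- The symbol class `S_{m,ρ}`. -/
def SClass (d m : ℕ) (ρ : ℝ) (W : Ed d → ℝ) : Prop :=
  ContDiff ℝ m W ∧ ∃ C : ℝ, 0 < C ∧ ∀ k : ℕ, k ≤ m → ∀ x : Ed d,
    ‖iteratedFDeriv ℝ k W x‖ ≤ C * (1 + ‖x‖) ^ (-ρ - (k : ℝ))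

/-- The cube `(-R/2, R/2)^d`. -/
def cube (d : ℕ) (R : ℝ) : Set (Ed d) := {x | ∀ i, |x i| < R / 2}

/-- Admissibility of `η` with mean value `η₀` witnessed by the solution `φ` of `Δφ = η - η₀`. -/
structure IsAdmissible (d : ℕ) (η : Ed d → ℝ) (η₀ : ℝ) (φ : Ed d → ℝ) : Prop where
  background_ne : ∃ x, η x ≠ η₀
  smooth : ContDiff ℝ 2 φ
  bounded : ∀ k : ℕ, k ≤ 2 → ∃ M : ℝ, ∀ x, ‖iteratedFDeriv ℝ k φ x‖ ≤ M
  poisson : ∀ x, lap d φ x = η x - η₀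
  normalized : Filter.limsup (fun R : ℝ => (∫ x in cube d R, φ x) / R ^ d) Filter.atTop = 0

/-- Volume of the unit ball of `ℝ^d`. -/
noncomputable def tau (d : ℕ) : ℝ := (volume (Metric.ball (0 : Ed d) 1)).toReal

/-- Semiclassical counting function. -/
noncomputable def Ncl (d : ℕ) (V : Ed d → ℝ) (E : ℝ) : ℝ :=
  (tau d / (2 * π) ^ d) * ∫ x, (max (E - V x) 0) ^ ((d : ℝ) / 2)


/-! ### One-dimensional trigonometric integrals -/

lemma int_cos_int (m : ℤ) : ∫ t in Icc (0:ℝ) 1, cos (π * m * t) = if m = 0 then 1 else 0 := by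
  rw [integral_Icc_eq_integral_Ioc, ← intervalIntegral.integral_of_le zero_le_one]
  split_ifs with h
  · simp [h]
  · have hne : π * (m:ℝ) ≠ 0 := mul_ne_zero pi_ne_zero (by exact_mod_cast h)
    rw [intervalIntegral.integral_comp_mul_left (fun t => cos t) hne]
    simp [integral_cos]
    right
    rw [mul_comm]; exact sin_int_mul_pi m

lemma cont_intOn_Icc {f : ℝ → ℝ} (hf : Continuous f) : IntegrableOn f (Icc (0:ℝ) 1) :=
  hf.continuousOn.integrableOn_Icc

lemma int_cos_cos (m n : ℕ) : ∫ t in Icc (0:ℝ) 1, cos (π * m * t) * cos (π * n * t) =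
    if m = n then (if m = 0 then 1 else 1 / 2) else 0 := by
  have h : ∀ t : ℝ, cos (π * m * t) * cos (π * n * t) =
      (1/2) * (cos (π * ((m:ℤ) - (n:ℤ) : ℤ) * t)) + (1/2) * (cos (π * ((m:ℤ) + (n:ℤ) : ℤ) * t)) := by
    intro t
    push_cast
    rw [show π * ((m:ℝ) - n) * t = π * m * t - π * n * t by ring,
      show π * ((m:ℝ) + n) * t = π * m * t + π * n * t by ring, cos_sub, cos_add]
    ring
  simp_rw [h]
  rw [integral_add (cont_intOn_Icc (by fun_prop)) (cont_intOn_Icc (by fun_prop)),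
    integral_const_mul, integral_const_mul, int_cos_int, int_cos_int]
  split_ifs <;> first | omega | norm_num

lemma int_sin_sin (m n : ℕ) : ∫ t in Icc (0:ℝ) 1, sin (π * m * t) * sin (π * n * t) =
    if m = n then (if m = 0 then 0 else 1 / 2) else 0 := by
  have h : ∀ t : ℝ, sin (π * m * t) * sin (π * n * t) =
      (1/2) * (cos (π * ((m:ℤ) - (n:ℤ) : ℤ) * t)) - (1/2) * (cos (π * ((m:ℤ) + (n:ℤ) : ℤ) * t)) := by
    intro t
    push_cast
    rw [show π * ((m:ℝ) - n) * t = π * m * t - π * n * t by ring,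
      show π * ((m:ℝ) + n) * t = π * m * t + π * n * t by ring, cos_sub, cos_add]
    ring
  simp_rw [h]
  rw [integral_sub (cont_intOn_Icc (by fun_prop)) (cont_intOn_Icc (by fun_prop)),
    integral_const_mul, integral_const_mul, int_cos_int, int_cos_int]
  split_ifs <;> first | omega | norm_num

/-! ### Products on the unit cube -/

lemma int_cube_prod {d : ℕ} (f : Fin d → ℝ → ℝ) :
    ∫ x in Icc (0 : Fin d → ℝ) 1, ∏ i, f i (x i) = ∏ i, ∫ t in Icc (0:ℝ) 1, f i t := by
  have h : (volume : Measure (Fin d → ℝ)).restrict (Icc (0 : Fin d → ℝ) 1) =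
      Measure.pi (fun _ : Fin d => (volume : Measure ℝ).restrict (Icc (0:ℝ) 1)) := by
    rw [← Measure.restrict_pi_pi, Set.pi_univ_Icc]
    rfl
  rw [h, integral_fintype_prod_eq_prod]

def cosP {d : ℕ} (k : Fin d → ℕ) (x : Fin d → ℝ) : ℝ := ∏ i, cos (π * k i * x i)

def sinP {d : ℕ} (i : Fin d) (k : Fin d → ℕ) (x : Fin d → ℝ) : ℝ :=
  ∏ j, (if j = i then sin (π * k j * x j) else cos (π * k j * x j))

def nrmP {d : ℕ} (k : Fin d → ℕ) : ℝ := ∏ i, (if k i = 0 then (1:ℝ) else 1 / 2)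

lemma nrmP_pos {d : ℕ} (k : Fin d → ℕ) : 0 < nrmP k := by
  unfold nrmP
  apply Finset.prod_pos
  intro i _
  split_ifs <;> norm_num

lemma cosP_cont {d : ℕ} (k : Fin d → ℕ) : Continuous (cosP k) := by
  unfold cosP; fun_prop

lemma sinP_cont {d : ℕ} (i : Fin d) (k : Fin d → ℕ) : Continuous (sinP i k) := by
  unfold sinP
  apply continuous_finsetProd
  intro j _
  split_ifs <;> fun_prop

lemma prod_delta {d : ℕ} (k l : Fin d → ℕ) (g : Fin d → ℝ) :
    (∏ i, (if k i = l i then g i else 0)) = if k = l then ∏ i, g i else 0 := by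
  split_ifs with h
  · subst h; simp
  · obtain ⟨i, hi⟩ := Function.ne_iff.mp h
    exact Finset.prod_eq_zero (Finset.mem_univ i) (by simp [hi])

lemma int_cosP_cosP {d : ℕ} (k l : Fin d → ℕ) :
    ∫ x in Icc (0 : Fin d → ℝ) 1, cosP k x * cosP l x = if k = l then nrmP k else 0 := by
  simp only [cosP, ← Finset.prod_mul_distrib]
  rw [int_cube_prod (fun i t => cos (π * k i * t) * cos (π * l i * t))]
  simp_rw [int_cos_cos]
  rw [prod_delta]; rfl

lemma int_sinP_sinP {d : ℕ} (i : Fin d) (k l : Fin d → ℕ) (hk : k i ≠ 0) :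
    ∫ x in Icc (0 : Fin d → ℝ) 1, sinP i k x * sinP i l x = if k = l then nrmP k else 0 := by
  simp only [sinP, ← Finset.prod_mul_distrib]
  rw [int_cube_prod (fun j t => (if j = i then sin (π * k j * t) else cos (π * k j * t)) *
    (if j = i then sin (π * l j * t) else cos (π * l j * t)))]
  rw [nrmP, ← prod_delta]
  apply Finset.prod_congr rfl
  intro j _
  by_cases hj : j = i
  · subst hj; simp [int_sin_sin, hk]
  · simp only [hj, if_false]; rw [int_cos_cos]

lemma cont_intOn_cube {d : ℕ} {f : (Fin d → ℝ) → ℝ} (hf : Continuous f) :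
    IntegrableOn f (Icc (0 : Fin d → ℝ) 1) :=
  hf.continuousOn.integrableOn_Icc

/-- Expansion of the square distance to an orthogonal sum. -/
lemma int_sq_expand {d : ℕ} {ι : Type*} [DecidableEq ι] (B : Finset ι)
    (e : ι → (Fin d → ℝ) → ℝ) (he : ∀ k, Continuous (e k)) (w : ι → ℝ)
    (ho : ∀ k ∈ B, ∀ l ∈ B, ∫ x in Icc (0 : Fin d → ℝ) 1, e k x * e l x = if k = l then w k else 0)
    (f : (Fin d → ℝ) → ℝ) (hf : Continuous f) (c : ι → ℝ) :
    ∫ x in Icc (0 : Fin d → ℝ) 1, (f x - ∑ k ∈ B, c k * e k x) ^ 2 =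
      (∫ x in Icc (0 : Fin d → ℝ) 1, f x ^ 2)
        - 2 * ∑ k ∈ B, c k * (∫ x in Icc (0 : Fin d → ℝ) 1, f x * e k x)
        + ∑ k ∈ B, c k ^ 2 * w k := by
  have h : ∀ x, (f x - ∑ k ∈ B, c k * e k x) ^ 2 =
      f x ^ 2 - ∑ k ∈ B, (2 * c k) * (f x * e k x)
        + ∑ k ∈ B, ∑ l ∈ B, (c k * c l) * (e k x * e l x) := by
    intro x
    have h1 : ∑ k ∈ B, ∑ l ∈ B, (c k * c l) * (e k x * e l x) = (∑ k ∈ B, c k * e k x) ^ 2 := by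
      rw [sq, Finset.sum_mul_sum]
      exact Finset.sum_congr rfl fun k _ => Finset.sum_congr rfl fun l _ => by ring
    have h2 : ∑ k ∈ B, (2 * c k) * (f x * e k x) = 2 * f x * ∑ k ∈ B, c k * e k x := by
      rw [Finset.mul_sum]
      exact Finset.sum_congr rfl fun k _ => by ring
    rw [h1, h2]; ring
  simp_rw [h]
  have i0 : IntegrableOn (fun x => f x ^ 2) (Icc (0 : Fin d → ℝ) 1) := cont_intOn_cube (by fun_prop)
  have i1 : IntegrableOn (fun x => ∑ k ∈ B, (2 * c k) * (f x * e k x)) (Icc (0 : Fin d → ℝ) 1) :=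
    cont_intOn_cube (by fun_prop)
  have i2 : IntegrableOn (fun x => ∑ k ∈ B, ∑ l ∈ B, (c k * c l) * (e k x * e l x))
      (Icc (0 : Fin d → ℝ) 1) := cont_intOn_cube (by fun_prop)
  have i01 : IntegrableOn (fun x => f x ^ 2 - ∑ k ∈ B, (2 * c k) * (f x * e k x))
      (Icc (0 : Fin d → ℝ) 1) := cont_intOn_cube (by fun_prop)
  rw [integral_add i01 i2, integral_sub i0 i1]
  congr 1
  · congr 1
    rw [integral_finsetSum _ (fun k _ => cont_intOn_cube (by fun_prop)), Finset.mul_sum]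
    refine Finset.sum_congr rfl fun k _ => ?_
    rw [integral_const_mul]; ring
  · rw [integral_finsetSum _ (fun k _ => cont_intOn_cube (by fun_prop))]
    refine Finset.sum_congr rfl fun k hk => ?_
    rw [integral_finsetSum _ (fun k _ => cont_intOn_cube (by fun_prop))]
    rw [Finset.sum_eq_single k]
    · rw [integral_const_mul, ho k hk k hk, if_pos rfl]; ring
    · intro l hl hlk
      rw [integral_const_mul, ho k hk l hl]; simp [hlk.symm]
    · intro h; exact absurd hk h

lemma bessel_cube {d : ℕ} {ι : Type*} [DecidableEq ι] (B : Finset ι)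
    (e : ι → (Fin d → ℝ) → ℝ) (he : ∀ k, Continuous (e k)) (w : ι → ℝ) (hw : ∀ k, 0 < w k)
    (ho : ∀ k ∈ B, ∀ l ∈ B, ∫ x in Icc (0 : Fin d → ℝ) 1, e k x * e l x = if k = l then w k else 0)
    (f : (Fin d → ℝ) → ℝ) (hf : Continuous f) :
    ∑ k ∈ B, (∫ x in Icc (0 : Fin d → ℝ) 1, f x * e k x) ^ 2 / w k
      ≤ ∫ x in Icc (0 : Fin d → ℝ) 1, f x ^ 2 := by
  have h := int_sq_expand B e he w ho f hf
    (fun k => (∫ x in Icc (0 : Fin d → ℝ) 1, f x * e k x) / w k)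
  have h0 : 0 ≤ ∫ x in Icc (0 : Fin d → ℝ) 1, (f x - ∑ k ∈ B,
    ((∫ x in Icc (0 : Fin d → ℝ) 1, f x * e k x) / w k) * e k x) ^ 2 :=
    integral_nonneg fun x => sq_nonneg _
  rw [h] at h0
  have h1 : ∑ k ∈ B, ((∫ x in Icc (0 : Fin d → ℝ) 1, f x * e k x) / w k) *
      (∫ x in Icc (0 : Fin d → ℝ) 1, f x * e k x) =
      ∑ k ∈ B, (∫ x in Icc (0 : Fin d → ℝ) 1, f x * e k x) ^ 2 / w k :=
    Finset.sum_congr rfl fun k _ => by ring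
  have h2 : ∑ k ∈ B, ((∫ x in Icc (0 : Fin d → ℝ) 1, f x * e k x) / w k) ^ 2 * w k =
      ∑ k ∈ B, (∫ x in Icc (0 : Fin d → ℝ) 1, f x * e k x) ^ 2 / w k :=
    Finset.sum_congr rfl fun k _ => by
      have := (hw k).ne'
      field_simp
  rw [h1, h2] at h0
  linarith

/-- Best approximation. -/
lemma best_approx_cube {d : ℕ} {ι : Type*} [DecidableEq ι] (B : Finset ι)
    (e : ι → (Fin d → ℝ) → ℝ) (he : ∀ k, Continuous (e k)) (w : ι → ℝ) (hw : ∀ k, 0 < w k)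
    (ho : ∀ k ∈ B, ∀ l ∈ B, ∫ x in Icc (0 : Fin d → ℝ) 1, e k x * e l x = if k = l then w k else 0)
    (f : (Fin d → ℝ) → ℝ) (hf : Continuous f) (c : ι → ℝ) :
    (∫ x in Icc (0 : Fin d → ℝ) 1, f x ^ 2) ≤
      ∑ k ∈ B, (∫ x in Icc (0 : Fin d → ℝ) 1, f x * e k x) ^ 2 / w k +
      ∫ x in Icc (0 : Fin d → ℝ) 1, (f x - ∑ k ∈ B, c k * e k x) ^ 2 := by
  rw [int_sq_expand B e he w ho f hf c]
  have : 0 ≤ ∑ k ∈ B, ((∫ x in Icc (0 : Fin d → ℝ) 1, f x * e k x) ^ 2 / w k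
      - 2 * (c k * (∫ x in Icc (0 : Fin d → ℝ) 1, f x * e k x)) + c k ^ 2 * w k) := by
    refine Finset.sum_nonneg fun k _ => ?_
    have hk := hw k
    set a := ∫ x in Icc (0 : Fin d → ℝ) 1, f x * e k x
    have : a ^ 2 / w k - 2 * (c k * a) + c k ^ 2 * w k = (a - c k * w k) ^ 2 / w k := by
      field_simp; ring
    rw [this]; positivity
  rw [Finset.sum_add_distrib, Finset.sum_sub_distrib, ← Finset.mul_sum] at this
  linarith


/-! ### Density of cosine products -/

def cosC {d : ℕ} (k : Fin d → ℕ) : C(Icc (0 : Fin d → ℝ) 1, ℝ) :=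
  ⟨fun x => cosP k x.1, (cosP_cont k).comp continuous_subtype_val⟩

lemma cosP_mul_gen {d : ℕ} (k : Fin d → ℕ) (i : Fin d) (x : Fin d → ℝ) :
    cosP k x * cos (π * x i) =
      if k i = 0 then cosP (Function.update k i (k i + 1)) x else
      (1/2) * cosP (Function.update k i (k i + 1)) x +
      (1/2) * cosP (Function.update k i (k i - 1)) x := by
  have key : ∀ m : ℕ, cosP (Function.update k i m) x =
      cos (π * m * x i) * ∏ j ∈ Finset.univ.erase i, cos (π * k j * x j) := by
    intro m
    unfold cosP
    rw [← Finset.mul_prod_erase _ _ (Finset.mem_univ i)]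
    congr 1
    · simp
    · refine Finset.prod_congr rfl fun j hj => ?_
      rw [Function.update_of_ne (Finset.ne_of_mem_erase hj)]
  have h0 : cosP k x = cosP (Function.update k i (k i)) x := by simp
  rw [h0, key, key, key]
  split_ifs with h
  · simp [h]; ring
  · obtain ⟨m, hm⟩ := Nat.exists_eq_succ_of_ne_zero h
    rw [hm]
    simp only [Nat.succ_eq_add_one, Nat.add_sub_cancel]
    push_cast
    rw [show π * ((m:ℝ) + 1 + 1) * x i = π * (m + 1) * x i + π * x i by ring,
      show π * (m:ℝ) * x i = π * (m + 1) * x i - π * x i by ring, cos_sub, cos_add]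
    ring

lemma cos_dense {d : ℕ} (f : (Fin d → ℝ) → ℝ) (hf : Continuous f) (ε : ℝ) (hε : 0 < ε) :
    ∃ c : (Fin d → ℕ) →₀ ℝ, ∀ x ∈ Icc (0 : Fin d → ℝ) 1,
      |f x - ∑ k ∈ c.support, c k * cosP k x| < ε := by
  let gen : Fin d → C(Icc (0 : Fin d → ℝ) 1, ℝ) := fun i =>
    ⟨fun x => cos (π * x.1 i), by
      have : Continuous fun x : Icc (0 : Fin d → ℝ) 1 => x.1 i :=
        (continuous_apply i).comp continuous_subtype_val
      exact continuous_cos.comp (continuous_const.mul this)⟩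
  let A : Subalgebra ℝ C(Icc (0 : Fin d → ℝ) 1, ℝ) := Algebra.adjoin ℝ (range gen)
  have hsep : A.SeparatesPoints := by
    intro x y hxy
    have : ∃ i, x.1 i ≠ y.1 i := by
      by_contra! h
      exact hxy (Subtype.ext (funext h))
    obtain ⟨i, hi⟩ := this
    refine ⟨gen i, ⟨gen i, Algebra.subset_adjoin ⟨i, rfl⟩, rfl⟩, ?_⟩
    intro h
    apply hi
    have h' : cos (π * x.1 i) = cos (π * y.1 i) := h
    have hx := x.2; have hy := y.2
    have hx0 := hx.1 i; have hx1 := hx.2 i; have hy0 := hy.1 i; have hy1 := hy.2 i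
    simp only [Pi.zero_apply, Pi.one_apply] at hx0 hx1 hy0 hy1
    have := Real.injOn_cos (x₁ := π * x.1 i) (x₂ := π * y.1 i)
      ⟨by positivity, by nlinarith [pi_pos]⟩ ⟨by positivity, by nlinarith [pi_pos]⟩ h'
    exact mul_left_cancel₀ pi_ne_zero this
  obtain ⟨g, hg⟩ := ContinuousMap.exists_mem_subalgebra_near_continuous_of_separatesPoints A hsep
    (fun x => f x.1) (hf.comp continuous_subtype_val) ε hε
  have hspan : ∀ g ∈ A, g ∈ Submodule.span ℝ (range (cosC (d := d))) := by
    intro g hg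
    have : g ∈ Subalgebra.toSubmodule A := hg
    rw [Algebra.adjoin_eq_span] at this
    refine (Submodule.span_le.mpr ?_) this
    intro z hz
    refine Submonoid.closure_induction_right (motive := fun z _ =>
      z ∈ Submodule.span ℝ (range (cosC (d := d)))) ?_ ?_ hz
    · refine Submodule.subset_span ⟨0, ?_⟩
      ext x; simp [cosC, cosP]
    · rintro z hz0 _ ⟨i, rfl⟩ hz
      clear hz0
      induction hz using Submodule.span_induction with
      | mem z hz =>
        obtain ⟨k, rfl⟩ := hz
        have : cosC k * gen i = if k i = 0 then cosC (Function.update k i (k i + 1)) else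
          (1/2 : ℝ) • cosC (Function.update k i (k i + 1)) +
          (1/2 : ℝ) • cosC (Function.update k i (k i - 1)) := by
          ext x
          have := cosP_mul_gen k i x.1
          split_ifs with h
          · rw [if_pos h] at this
            exact this
          · rw [if_neg h] at this
            exact this
        rw [this]
        split_ifs
        · exact Submodule.subset_span ⟨_, rfl⟩
        · exact Submodule.add_mem _ (Submodule.smul_mem _ _ (Submodule.subset_span ⟨_, rfl⟩))
            (Submodule.smul_mem _ _ (Submodule.subset_span ⟨_, rfl⟩))
      | zero => simp
      | add a b _ _ ha hb => rw [add_mul]; exact Submodule.add_mem _ ha hb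
      | smul r a _ ha => rw [smul_mul_assoc]; exact Submodule.smul_mem _ _ ha
  have hg2 := hspan g.1 g.2
  rw [Finsupp.mem_span_range_iff_exists_finsupp] at hg2
  obtain ⟨c, hc⟩ := hg2
  refine ⟨c, fun x hx => ?_⟩
  have := hg ⟨x, hx⟩
  rw [← hc, Real.norm_eq_abs, abs_sub_comm] at this
  simpa [Finsupp.sum, cosC] using this

/-! ### Integration by parts -/

lemma hasFDerivAt_sinP {d : ℕ} (i : Fin d) (k : Fin d → ℕ) (x : Fin d → ℝ) :
    ∃ L : (Fin d → ℝ) →L[ℝ] ℝ, HasFDerivAt (sinP i k) L x ∧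
      L (Pi.single i 1) = π * k i * cosP k x := by
  have hd : DifferentiableAt ℝ (sinP i k) x := by
    unfold sinP
    have : ∀ j ∈ (Finset.univ : Finset (Fin d)), DifferentiableAt ℝ (fun x : Fin d → ℝ =>
      (if j = i then sin (π * k j * x j) else cos (π * k j * x j))) x := by
      intro j _
      split_ifs <;> fun_prop
    exact (HasFDerivAt.finsetProd (u := Finset.univ) (x := x)
      (g := fun (j : Fin d) (x : Fin d → ℝ) =>
        (if j = i then sin (π * k j * x j) else cos (π * k j * x j)))
        (fun j hj => (this j hj).hasFDerivAt)).differentiableAt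
  refine ⟨_, hd.hasFDerivAt, ?_⟩
  have h1 : HasDerivAt (fun t : ℝ => x + t • (Pi.single i 1 : Fin d → ℝ)) (Pi.single i 1) 0 := by
    simpa using ((hasDerivAt_id (0:ℝ)).smul_const (Pi.single i (1:ℝ) : Fin d → ℝ)).const_add x
  have h2 := HasFDerivAt.comp_hasDerivAt (f := fun t : ℝ => x + t • (Pi.single i 1 : Fin d → ℝ))
    (l := sinP i k) (l' := fderiv ℝ (sinP i k) x) 0 (by simpa using hd.hasFDerivAt) h1
  have h3 : (sinP i k ∘ fun t : ℝ => x + t • (Pi.single i 1 : Fin d → ℝ)) =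
      fun t => sin (π * k i * (x i + t)) * ∏ j ∈ Finset.univ.erase i, cos (π * k j * x j) := by
    funext t
    simp only [Function.comp, sinP]
    rw [← Finset.mul_prod_erase _ _ (Finset.mem_univ i)]
    congr 1
    · simp
    · refine Finset.prod_congr rfl fun j hj => ?_
      have hj' := Finset.ne_of_mem_erase hj
      simp [hj']
  rw [h3] at h2
  have h4 : HasDerivAt (fun t : ℝ => sin (π * k i * (x i + t)) *
      ∏ j ∈ Finset.univ.erase i, cos (π * k j * x j))
      (cos (π * k i * (x i + 0)) * (π * k i * 1) *
      ∏ j ∈ Finset.univ.erase i, cos (π * k j * x j)) 0 := by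
    refine HasDerivAt.mul_const ?_ _
    exact (((hasDerivAt_id (0:ℝ)).const_add (x i)).const_mul (π * k i)).sin
  rw [h2.unique h4]
  unfold cosP
  rw [← Finset.mul_prod_erase _ _ (Finset.mem_univ i)]
  simp; ring

lemma cube_by_parts {d : ℕ} (i : Fin d) (k : Fin d → ℕ) (w : (Fin d → ℝ) → ℝ)
    (hw : ContDiff ℝ 1 w) :
    ∫ x in Icc (0 : Fin d → ℝ) 1, fderiv ℝ w x (Pi.single i 1) * sinP i k x =
      - (π * k i) * ∫ x in Icc (0 : Fin d → ℝ) 1, w x * cosP k x := by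
  obtain ⟨n, rfl⟩ : ∃ n, d = n + 1 := Nat.exists_eq_succ_of_ne_zero (by rintro rfl; exact i.elim0)
  choose L hL hL' using fun x => hasFDerivAt_sinP i k x
  have hwd : ∀ x, HasFDerivAt w (fderiv ℝ w x) x := fun x =>
    (hw.differentiable (by norm_num) x).hasFDerivAt
  have hwc : Continuous (fun x => fderiv ℝ w x (Pi.single i 1)) :=
    (hw.continuous_fderiv (by norm_num)).clm_apply continuous_const
  have hw0 := hw.continuous
  have hs := sinP_cont i k
  have hc := cosP_cont k
  have hval : ∀ x, ∑ j, (if j = i then w x • L x + sinP i k x • fderiv ℝ w x else 0 :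
      (Fin (n+1) → ℝ) →L[ℝ] ℝ) (Pi.single j 1) =
      fderiv ℝ w x (Pi.single i 1) * sinP i k x + (π * k i) * (w x * cosP k x) := by
    intro x
    rw [Finset.sum_eq_single i]
    · simp [hL']; ring
    · intro j _ hj; simp [hj]
    · simp
  have key := integral_divergence_of_hasFDerivAt_off_countable' (E := ℝ)
    (0 : Fin (n+1) → ℝ) 1 (by intro j; simp)
    (fun j x => if j = i then w x * sinP i k x else 0)
    (fun j x => if j = i then w x • L x + sinP i k x • fderiv ℝ w x else 0) ∅ countable_empty
    (by
      intro j
      split_ifs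
      · exact (by fun_prop : Continuous fun x => w x * sinP i k x).continuousOn
      · exact continuousOn_const)
    (by
      intro x _ j
      split_ifs
      · exact (hwd x).mul (hL x)
      · exact hasFDerivAt_const _ _)
    (by
      simp_rw [hval]
      exact cont_intOn_cube (by fun_prop))
  simp_rw [hval] at key
  rw [integral_add (cont_intOn_cube (by fun_prop)) (cont_intOn_cube (by fun_prop)),
    integral_const_mul] at key
  have hz : ∀ (c : ℝ), sin (π * k i * c) = 0 → ∀ y, sinP i k (Fin.insertNth i c y) = 0 := by
    intro c hc y
    unfold sinP
    refine Finset.prod_eq_zero (Finset.mem_univ i) ?_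
    simpa using hc
  have hR : ∑ j : Fin (n + 1), ((∫ x in Icc ((0 : Fin (n+1) → ℝ) ∘ j.succAbove) ((1 : Fin (n+1) → ℝ) ∘ j.succAbove),
        (if j = i then w (j.insertNth ((1 : Fin (n+1) → ℝ) j) x) *
          sinP i k (j.insertNth ((1 : Fin (n+1) → ℝ) j) x) else 0)) -
        ∫ x in Icc ((0 : Fin (n+1) → ℝ) ∘ j.succAbove) ((1 : Fin (n+1) → ℝ) ∘ j.succAbove),
        (if j = i then w (j.insertNth ((0 : Fin (n+1) → ℝ) j) x) *
          sinP i k (j.insertNth ((0 : Fin (n+1) → ℝ) j) x) else 0)) = 0 := by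
    refine Finset.sum_eq_zero fun j _ => ?_
    by_cases hj : j = i
    · subst hj
      have e1 := hz 1 (by rw [mul_one, mul_comm]; exact sin_nat_mul_pi _)
      have e0 := hz 0 (by simp)
      simp [e1, e0]
    · simp [hj]
  have := key.trans hR
  linarith

/-! ### The Neumann bound on the unit cube -/

lemma neumann_unit {d : ℕ} (w : (Fin d → ℝ) → ℝ) (hw : ContDiff ℝ 1 w) (lam : ℝ)
    (h : ∀ k : Fin d → ℕ, ∑ i, (π * k i) ^ 2 < lam →
      ∫ x in Icc (0 : Fin d → ℝ) 1, w x * cosP k x = 0) :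
    lam * ∫ x in Icc (0 : Fin d → ℝ) 1, w x ^ 2 ≤
      ∫ x in Icc (0 : Fin d → ℝ) 1, ∑ i, (fderiv ℝ w x (Pi.single i 1)) ^ 2 := by
  have hwc : ∀ i, Continuous (fun x => fderiv ℝ w x (Pi.single i 1)) := fun i =>
    (hw.continuous_fderiv (by norm_num)).clm_apply continuous_const
  have hw0 := hw.continuous
  rcases le_or_gt lam 0 with hl | hl
  · refine le_trans (mul_nonpos_of_nonpos_of_nonneg hl (integral_nonneg fun x => sq_nonneg _)) ?_
    exact integral_nonneg fun x => Finset.sum_nonneg fun i _ => sq_nonneg _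
  set a : (Fin d → ℕ) → ℝ := fun k => ∫ x in Icc (0 : Fin d → ℝ) 1, w x * cosP k x with ha
  -- Bessel for the derivatives
  have hB : ∀ (B : Finset (Fin d → ℕ)) (i : Fin d), ∑ k ∈ B, (π * k i) ^ 2 * (a k ^ 2 / nrmP k) ≤
      ∫ x in Icc (0 : Fin d → ℝ) 1, (fderiv ℝ w x (Pi.single i 1)) ^ 2 := by
    intro B i
    have h1 := bessel_cube (B.filter (fun k => k i ≠ 0)) (sinP i) (sinP_cont i) nrmP nrmP_pos
      (by
        intro k hk l hl
        exact int_sinP_sinP i k l (Finset.mem_filter.mp hk).2) _ (hwc i)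
    refine le_trans (le_of_eq ?_) h1
    rw [Finset.sum_filter]
    refine Finset.sum_congr rfl fun k _ => ?_
    split_ifs with hk
    · rw [cube_by_parts i k w hw]
      ring
    · push Not at hk
      simp [hk]
  have hsum : ∫ x in Icc (0 : Fin d → ℝ) 1, ∑ i, (fderiv ℝ w x (Pi.single i 1)) ^ 2 =
      ∑ i, ∫ x in Icc (0 : Fin d → ℝ) 1, (fderiv ℝ w x (Pi.single i 1)) ^ 2 :=
    integral_finsetSum _ fun i _ => cont_intOn_cube (by have := hwc i; fun_prop)
  have hB2 : ∀ B : Finset (Fin d → ℕ), lam * ∑ k ∈ B, a k ^ 2 / nrmP k ≤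
      ∫ x in Icc (0 : Fin d → ℝ) 1, ∑ i, (fderiv ℝ w x (Pi.single i 1)) ^ 2 := by
    intro B
    rw [hsum]
    refine le_trans ?_ (Finset.sum_le_sum fun i _ => hB B i)
    rw [Finset.sum_comm, Finset.mul_sum]
    refine Finset.sum_le_sum fun k _ => ?_
    rw [← Finset.sum_mul]
    have hn := nrmP_pos k
    rcases lt_or_ge (∑ i, (π * k i) ^ 2) lam with hk | hk
    · have : a k = 0 := h k hk
      simp [this]
    · gcongr
  refine le_of_forall_pos_le_add fun ε hε => ?_
  have hδ : 0 < sqrt (ε / lam) := sqrt_pos.mpr (by positivity)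
  obtain ⟨c, hc⟩ := cos_dense w hw0 _ hδ
  have h2 := best_approx_cube c.support cosP cosP_cont nrmP nrmP_pos
    (fun k _ l _ => int_cosP_cosP k l) w hw0 c
  have h3 : ∫ x in Icc (0 : Fin d → ℝ) 1, (w x - ∑ k ∈ c.support, c k * cosP k x) ^ 2 ≤ ε / lam := by
    have hcc : ∀ k, Continuous (cosP (d := d) k) := cosP_cont
    calc _ ≤ ∫ x in Icc (0 : Fin d → ℝ) 1, ε / lam := by
          refine setIntegral_mono_on (cont_intOn_cube (by fun_prop)) (cont_intOn_cube (by fun_prop))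
            measurableSet_Icc fun x hx => ?_
          rw [← sq_sqrt (by positivity : 0 ≤ ε / lam)]
          exact sq_le_sq' (by linarith [abs_lt.mp (hc x hx)]) (by linarith [abs_lt.mp (hc x hx)])
      _ = ε / lam := by
          simp [Measure.real, Real.volume_Icc_pi]
  calc lam * ∫ x in Icc (0 : Fin d → ℝ) 1, w x ^ 2
      ≤ lam * (∑ k ∈ c.support, a k ^ 2 / nrmP k + ε / lam) := by
        gcongr; linarith
    _ = lam * (∑ k ∈ c.support, a k ^ 2 / nrmP k) + ε := by field_simp
    _ ≤ _ := by linarith [hB2 c.support]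


/-! ### Cubes in Euclidean space -/

def gcube {d : ℕ} (l : ℝ) (n : Fin d → ℤ) : Set (Ed d) :=
  {x | ∀ i, l * n i ≤ x i ∧ x i < l * (n i + 1)}

def aff {d : ℕ} (l : ℝ) (n : Fin d → ℤ) (y : Fin d → ℝ) : Ed d :=
  WithLp.toLp 2 (fun i => l * (n i + y i))

lemma measurableSet_gcube {d : ℕ} (l : ℝ) (n : Fin d → ℤ) : MeasurableSet (gcube l n) := by
  have : gcube l n = ⋂ i, {x : Ed d | l * n i ≤ x i ∧ x i < l * (n i + 1)} := by
    ext x; simp [gcube]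
  rw [this]
  refine MeasurableSet.iInter fun i => ?_
  have hm : Measurable fun x : Ed d => x i := by fun_prop
  exact (measurableSet_le measurable_const hm).inter (measurableSet_lt hm measurable_const)

lemma aff_contDiff {d : ℕ} (l : ℝ) (n : Fin d → ℤ) {k : WithTop ℕ∞} :
    ContDiff ℝ k (aff (d := d) l n) := by
  unfold aff
  exact (PiLp.contDiff_toLp (𝕜 := ℝ) (p := 2)).comp (by fun_prop)

lemma int_gcube {d : ℕ} {l : ℝ} (hl : 0 < l) (n : Fin d → ℤ) (g : Ed d → ℝ) :
    ∫ x in gcube l n, g x = l ^ d * ∫ y in Icc (0 : Fin d → ℝ) 1, g (aff l n y) := by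
  have h1 : ∫ x in gcube l n, g x =
      ∫ z in (WithLp.toLp 2) ⁻¹' (gcube (d := d) l n), g (WithLp.toLp 2 z) :=
    ((PiLp.volume_preserving_toLp (Fin d)).setIntegral_preimage_emb
      (MeasurableEquiv.toLp 2 (Fin d → ℝ)).measurableEmbedding g (gcube l n)).symm
  have h2 : ((WithLp.toLp 2) ⁻¹' (gcube (d := d) l n) : Set (Fin d → ℝ)) =
      Set.pi univ (fun i => Ico (l * n i) (l * (n i + 1))) := by
    ext z; simp [gcube]
  have h3 : ((WithLp.toLp 2) ⁻¹' (gcube (d := d) l n) : Set (Fin d → ℝ)) =ᵐ[volume]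
      Icc (fun i => l * (n i : ℝ)) (fun i => l * ((n i : ℝ) + 1)) := by
    rw [h2]
    exact Measure.univ_pi_Ico_ae_eq_Icc
  rw [h1, setIntegral_congr_set h3, ← integral_indicator measurableSet_Icc,
    ← integral_indicator measurableSet_Icc]
  set F : (Fin d → ℝ) → ℝ := (Icc (fun i => l * (n i : ℝ)) (fun i => l * ((n i : ℝ) + 1))).indicator
    (fun z => g (WithLp.toLp 2 z)) with hF
  have h4 : (Icc (0 : Fin d → ℝ) 1).indicator (fun y => g (aff l n y)) =
      fun y => F (l • (y + (fun i => (n i : ℝ)))) := by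
    funext y
    have hmem : (l • (y + (fun i => (n i : ℝ)))) ∈
        Icc (fun i => l * (n i : ℝ)) (fun i => l * ((n i : ℝ) + 1)) ↔ y ∈ Icc (0 : Fin d → ℝ) 1 := by
      simp only [mem_Icc, Pi.le_def, Pi.smul_apply, Pi.add_apply, smul_eq_mul, Pi.zero_apply,
        Pi.one_apply]
      constructor
      · rintro ⟨ha, hb⟩
        exact ⟨fun i => by have := le_of_mul_le_mul_left (ha i) hl; linarith,
          fun i => by have := le_of_mul_le_mul_left (hb i) hl; linarith⟩
      · rintro ⟨ha, hb⟩
        exact ⟨fun i => mul_le_mul_of_nonneg_left (by linarith [ha i]) hl.le,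
          fun i => mul_le_mul_of_nonneg_left (by linarith [hb i]) hl.le⟩
    by_cases hy : y ∈ Icc (0 : Fin d → ℝ) 1
    · rw [indicator_of_mem hy, hF, indicator_of_mem (hmem.mpr hy)]
      congr 1
      unfold aff
      congr 1
      funext i
      simp [add_comm]
    · rw [indicator_of_notMem hy, hF, indicator_of_notMem (fun h => hy (hmem.mp h))]
  rw [h4, integral_add_right_eq_self (fun y => F (l • y)), Measure.integral_comp_smul]
  simp only [Module.finrank_fintype_fun_eq_card, Fintype.card_fin, smul_eq_mul]
  rw [abs_of_pos (by positivity), ← mul_assoc, mul_inv_cancel₀ (by positivity), one_mul]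

lemma norm_gradient_sq {d : ℕ} (u : Ed d → ℝ) (x : Ed d) :
    ‖gradient u x‖ ^ 2 = ∑ i, (fderiv ℝ u x (EuclideanSpace.single i 1)) ^ 2 := by
  rw [EuclideanSpace.norm_sq_eq]
  refine Finset.sum_congr rfl fun i _ => ?_
  rw [Real.norm_eq_abs, sq_abs]
  congr 1
  have : fderiv ℝ u x (EuclideanSpace.single i 1) = inner ℝ (gradient u x) (EuclideanSpace.single i 1) := by
    unfold gradient
    rw [InnerProductSpace.toDual_symm_apply]
  rw [this, EuclideanSpace.inner_single_right]
  simp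

lemma fderiv_comp_aff {d : ℕ} (l : ℝ) (n : Fin d → ℤ) (u : Ed d → ℝ) (y : Fin d → ℝ)
    (hu : DifferentiableAt ℝ u (aff l n y)) (i : Fin d) :
    fderiv ℝ (fun y => u (aff l n y)) y (Pi.single i 1) =
      l * fderiv ℝ u (aff l n y) (EuclideanSpace.single i 1) := by
  have h1 : HasDerivAt (fun t : ℝ => y + t • (Pi.single i 1 : Fin d → ℝ)) (Pi.single i 1) 0 := by
    simpa using ((hasDerivAt_id (0:ℝ)).smul_const (Pi.single i (1:ℝ) : Fin d → ℝ)).const_add y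
  have h1' : HasDerivAt (fun t : ℝ => aff l n y + t • (l • EuclideanSpace.single i (1:ℝ) : Ed d))
      (l • EuclideanSpace.single i (1:ℝ)) 0 := by
    simpa using ((hasDerivAt_id (0:ℝ)).smul_const
      (l • EuclideanSpace.single i (1:ℝ) : Ed d)).const_add (aff l n y)
  have hd : DifferentiableAt ℝ (fun y => u (aff l n y)) y :=
    DifferentiableAt.comp y hu ((aff_contDiff l n (k := 1)).differentiable (by norm_num) y)
  have h2 := HasFDerivAt.comp_hasDerivAt (f := fun t : ℝ => y + t • (Pi.single i 1 : Fin d → ℝ))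
    (l := fun y => u (aff l n y)) (l' := fderiv ℝ (fun y => u (aff l n y)) y) 0
    (by simpa using hd.hasFDerivAt) h1
  have h2' := HasFDerivAt.comp_hasDerivAt
    (f := fun t : ℝ => aff l n y + t • (l • EuclideanSpace.single i (1:ℝ) : Ed d))
    (l := u) (l' := fderiv ℝ u (aff l n y)) 0
    (by simpa using hu.hasFDerivAt) h1'
  have h3 : ((fun y => u (aff l n y)) ∘ fun t : ℝ => y + t • (Pi.single i 1 : Fin d → ℝ)) =
      (u ∘ fun t : ℝ => aff l n y + t • (l • EuclideanSpace.single i (1:ℝ) : Ed d)) := by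
    funext t
    simp only [Function.comp]
    congr 1
    ext j
    by_cases hj : j = i
    · subst hj; simp [aff]; ring
    · simp [aff, hj]
  rw [h3] at h2
  rw [h2.unique h2', map_smul, smul_eq_mul]

lemma neumann_gcube {d : ℕ} {l : ℝ} (hl : 0 < l) (n : Fin d → ℤ) (u : Ed d → ℝ)
    (hu : ContDiff ℝ 1 u) (m : ℝ)
    (h : ∀ k : Fin d → ℕ, ∑ i, (π * k i) ^ 2 < l ^ 2 * m →
      ∫ y in Icc (0 : Fin d → ℝ) 1, u (aff l n y) * cosP k y = 0) :
    m * ∫ x in gcube l n, u x ^ 2 ≤ ∫ x in gcube l n, ‖gradient u x‖ ^ 2 := by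
  have hw : ContDiff ℝ 1 (fun y => u (aff l n y)) := hu.comp (aff_contDiff l n)
  have h1 := neumann_unit _ hw _ h
  rw [int_gcube hl, int_gcube hl]
  have h2 : ∀ y, ∑ i, (fderiv ℝ (fun y => u (aff l n y)) y (Pi.single i 1)) ^ 2 =
      l ^ 2 * ‖gradient u (aff l n y)‖ ^ 2 := by
    intro y
    rw [norm_gradient_sq, Finset.mul_sum]
    refine Finset.sum_congr rfl fun i _ => ?_
    rw [fderiv_comp_aff l n u y (hu.differentiable (by norm_num) _)]
    ring
  simp_rw [h2] at h1
  rw [integral_const_mul, mul_assoc] at h1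
  have h3 := le_of_mul_le_mul_left h1 (by positivity : 0 < l ^ 2)
  calc _ = l ^ d * (m * ∫ y in Icc (0 : Fin d → ℝ) 1, u (aff l n y) ^ 2) := by ring
    _ ≤ _ := by gcongr

/-! ### The test space and constraint counting -/

def XX (d : ℕ) : Submodule ℝ (Ed d → ℝ) where
  carrier := {u | ContDiff ℝ (⊤ : ℕ∞) u ∧ HasCompactSupport u}
  add_mem' := fun ha hb => ⟨ha.1.add hb.1, ha.2.add hb.2⟩
  zero_mem' := ⟨contDiff_const, HasCompactSupport.zero⟩
  smul_mem' := fun c _ hu => ⟨contDiff_const.smul hu.1, hu.2.smul_left (f := fun _ => c)⟩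

def dens {d : ℕ} (W u : Ed d → ℝ) (x : Ed d) : ℝ := ‖gradient u x‖ ^ 2 + W x * u x ^ 2

lemma cont_grad {d : ℕ} (u : Ed d → ℝ) (hu : ContDiff ℝ 1 u) :
    Continuous (fun x => ‖gradient u x‖ ^ 2) := by
  simp_rw [norm_gradient_sq]
  have : ∀ i, Continuous fun x => fderiv ℝ u x (EuclideanSpace.single i 1) := fun i =>
    (hu.continuous_fderiv (by norm_num)).clm_apply continuous_const
  fun_prop

lemma XX_one {d : ℕ} {u : Ed d → ℝ} (hu : u ∈ XX d) : ContDiff ℝ 1 u :=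
  hu.1.of_le (by exact_mod_cast le_top)

lemma int_grad {d : ℕ} {u : Ed d → ℝ} (hu : u ∈ XX d) :
    Integrable (fun x => ‖gradient u x‖ ^ 2) := by
  refine (cont_grad u (XX_one hu)).integrable_of_hasCompactSupport ?_
  refine (hu.2.fderiv (𝕜 := ℝ)).mono ?_
  intro x hx
  simp only [Function.mem_support] at hx ⊢
  intro h
  apply hx
  simp [gradient, h]

lemma int_pot {d : ℕ} {u W : Ed d → ℝ} (hu : u ∈ XX d) (hW : Continuous W) :
    Integrable (fun x => W x * u x ^ 2) := by
  have := (XX_one hu).continuous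
  refine Continuous.integrable_of_hasCompactSupport (by fun_prop) ?_
  refine hu.2.mono ?_
  intro x hx
  simp only [Function.mem_support] at hx ⊢
  intro h
  apply hx
  simp [h]

lemma int_dens {d : ℕ} {u W : Ed d → ℝ} (hu : u ∈ XX d) (hW : Continuous W) :
    Integrable (dens W u) := (int_grad hu).add (int_pot hu hW)

def Good {d : ℕ} (S : Set (Ed d)) (W : Ed d → ℝ) (a : ℝ) : Prop :=
  ∃ T : Finset (XX d →ₗ[ℝ] ℝ), (T.card : ℝ) ≤ a ∧
    ∀ u : XX d, (∀ φ ∈ T, φ u = 0) → 0 ≤ ∫ x in S, dens W u.1 x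

def cntSet (d : ℕ) (lam : ℝ) : Set (Fin d → ℕ) := {k | ∑ i, (π * k i) ^ 2 < lam}

lemma cntSet_finite (d : ℕ) (lam : ℝ) : (cntSet d lam).Finite := by
  refine (Set.finite_Iic (fun _ : Fin d => ⌊lam⌋₊)).subset ?_
  intro k hk i
  have hk' : ∑ i, (π * k i) ^ 2 < lam := hk
  have h1 : (π * k i) ^ 2 ≤ ∑ i, (π * (k i : ℝ)) ^ 2 :=
    Finset.single_le_sum (f := fun i => (π * (k i : ℝ)) ^ 2) (fun i _ => sq_nonneg _)
      (Finset.mem_univ i)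
  have h2 : (k i : ℝ) ≤ (π * k i) ^ 2 := by
    rcases Nat.eq_zero_or_pos (k i) with h | h
    · simp [h]
    · have : (1:ℝ) ≤ k i := by exact_mod_cast h
      have h3 : (1:ℝ) ≤ π := by linarith [pi_gt_three]
      have h4 : (k i : ℝ) ≤ π * k i := by nlinarith
      nlinarith
  exact Nat.le_floor (by linarith)

def cnt0 (d : ℕ) (lam : ℝ) : ℕ := (cntSet d lam).ncard

lemma good_gcube {d : ℕ} {l : ℝ} (hl : 0 < l) (n : Fin d → ℤ) (W : Ed d → ℝ) (hW : Continuous W)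
    (m : ℝ) (hm : ∀ x ∈ gcube l n, -m ≤ W x) : Good (gcube l n) W (cnt0 d (l ^ 2 * m)) := by
  classical
  let ph : (Fin d → ℕ) → (XX d →ₗ[ℝ] ℝ) := fun k =>
    { toFun := fun u => ∫ y in Icc (0 : Fin d → ℝ) 1, u.1 (aff l n y) * cosP k y
      map_add' := by
        intro u v
        have hu := (XX_one u.2).continuous
        have hv := (XX_one v.2).continuous
        have ha := (aff_contDiff (d := d) l n (k := 0)).continuous
        have hc := cosP_cont k
        rw [← integral_add (cont_intOn_cube (by fun_prop)) (cont_intOn_cube (by fun_prop))]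
        refine integral_congr_ae (Eventually.of_forall fun y => ?_)
        simp [add_mul]
      map_smul' := by
        intro c u
        simp only [RingHom.id_apply, smul_eq_mul]
        rw [← integral_const_mul]
        refine integral_congr_ae (Eventually.of_forall fun y => ?_)
        simp [mul_assoc] }
  refine ⟨(cntSet_finite d (l ^ 2 * m)).toFinset.image ph, ?_, ?_⟩
  · have := Finset.card_image_le (s := (cntSet_finite d (l ^ 2 * m)).toFinset) (f := ph)
    rw [cnt0, Set.ncard_eq_toFinset_card _ (cntSet_finite d (l ^ 2 * m))]
    exact_mod_cast this
  · intro u hu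
    have h1 := neumann_gcube hl n u.1 (XX_one u.2) m (fun k hk => by
      have := hu (ph k) (Finset.mem_image_of_mem _ ((Set.Finite.mem_toFinset _).mpr hk))
      exact this)
    have h2 : ∫ x in gcube l n, dens W u.1 x = (∫ x in gcube l n, ‖gradient u.1 x‖ ^ 2) +
        ∫ x in gcube l n, W x * u.1 x ^ 2 :=
      integral_add (int_grad u.2).integrableOn (int_pot u.2 hW).integrableOn
    have h3 : ∫ x in gcube l n, (-m) * u.1 x ^ 2 ≤ ∫ x in gcube l n, W x * u.1 x ^ 2 := by
      refine setIntegral_mono_on (int_pot u.2 continuous_const).integrableOn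
        (int_pot u.2 hW).integrableOn (measurableSet_gcube l n) fun x hx => ?_
      have := hm x hx
      gcongr
    rw [integral_const_mul] at h3
    rw [h2]
    linarith

lemma good_mono {d : ℕ} {S : Set (Ed d)} {W : Ed d → ℝ} {a b : ℝ} (h : Good S W a) (hab : a ≤ b) :
    Good S W b := by
  obtain ⟨T, hT, h⟩ := h
  exact ⟨T, hT.trans hab, h⟩

lemma good_union {d : ℕ} {S S' : Set (Ed d)} {W : Ed d → ℝ} {a b : ℝ} (hW : Continuous W)
    (hd : Disjoint S S') (hS' : MeasurableSet S') (h : Good S W a) (h' : Good S' W b) :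
    Good (S ∪ S') W (a + b) := by
  classical
  obtain ⟨T, hT, h⟩ := h
  obtain ⟨T', hT', h'⟩ := h'
  refine ⟨T ∪ T', ?_, fun u hu => ?_⟩
  · have : ((T ∪ T').card : ℝ) ≤ T.card + T'.card := by exact_mod_cast Finset.card_union_le T T'
    linarith
  · rw [setIntegral_union hd hS' (int_dens u.2 hW).integrableOn (int_dens u.2 hW).integrableOn]
    exact add_nonneg (h u fun φ hφ => hu φ (Finset.mem_union_left _ hφ))
      (h' u fun φ hφ => hu φ (Finset.mem_union_right _ hφ))

lemma good_nonneg {d : ℕ} {S : Set (Ed d)} {W : Ed d → ℝ} (hS : MeasurableSet S)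
    (h : ∀ x ∈ S, 0 ≤ W x) : Good S W 0 := by
  refine ⟨∅, by simp, fun u _ => setIntegral_nonneg hS fun x hx => ?_⟩
  have := h x hx
  unfold dens
  positivity

lemma good_biUnion {d : ℕ} {ι : Type*} (J : Finset ι) (S : ι → Set (Ed d)) {W : Ed d → ℝ}
    (a : ι → ℝ) (hW : Continuous W) (hS : ∀ j, MeasurableSet (S j))
    (hd : ∀ i j, i ≠ j → Disjoint (S i) (S j)) (h : ∀ j ∈ J, Good (S j) W (a j)) :
    Good (⋃ j ∈ J, S j) W (∑ j ∈ J, a j) := by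
  classical
  induction J using Finset.induction_on with
  | empty => simpa using good_nonneg (S := (∅ : Set (Ed d))) (W := W) MeasurableSet.empty (by simp)
  | insert j J hj ih =>
    rw [Finset.sum_insert hj, Finset.set_biUnion_insert]
    refine good_union hW ?_ (Finset.measurableSet_biUnion _ fun i _ => hS i)
      (h j (Finset.mem_insert_self _ _)) (ih fun i hi => h i (Finset.mem_insert_of_mem hi))
    rw [Set.disjoint_iUnion₂_right]
    intro i hi
    exact hd _ _ (by rintro rfl; exact hj hi)

lemma schN_le {d : ℕ} {V : Ed d → ℝ} {E : ℝ} (hV : Continuous V) {a : ℝ}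
    (h : Good univ (fun x => V x - E) a) : schN d V E ≠ ⊤ ∧ ((schN d V E).toNat : ℝ) ≤ a := by
  obtain ⟨T, hT, h⟩ := h
  have key : schN d V E ≤ (T.card : ℕ∞) := by
    unfold schN
    refine iSup_le ?_
    rintro ⟨F, hF1, hF2⟩
    have hFX : F ≤ XX d := fun u hu => hF1 u hu
    let Φ : F →ₗ[ℝ] (T → ℝ) := LinearMap.pi fun φ => φ.1.comp (Submodule.inclusion hFX)
    have hinj : Function.Injective Φ := by
      rw [← LinearMap.ker_eq_bot, LinearMap.ker_eq_bot']
      intro u hu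
      by_contra hne
      have hne' : u.1 ≠ 0 := fun h0 => hne (Subtype.ext h0)
      have h1 := hF2 u.1 u.2 hne'
      have h2 := h (Submodule.inclusion hFX u) (fun φ hφ => congrFun hu ⟨φ, hφ⟩)
      have hX : u.1 ∈ XX d := hFX u.2
      have h3 : ∫ x in univ, dens (fun x => V x - E) u.1 x =
          (∫ x, (‖gradient u.1 x‖ ^ 2 + V x * u.1 x ^ 2)) - E * ∫ x, u.1 x ^ 2 := by
        have hi : Integrable (fun x => ‖gradient u.1 x‖ ^ 2 + V x * u.1 x ^ 2) :=
          (int_grad hX).add (int_pot hX hV)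
        rw [setIntegral_univ, ← integral_const_mul,
          ← integral_sub hi (int_pot hX continuous_const)]
        refine integral_congr_ae (Eventually.of_forall fun x => ?_)
        simp only [dens]; ring
      have h2' : 0 ≤ ∫ x in univ, dens (fun x => V x - E) u.1 x := h2
      rw [h3] at h2'
      linarith
    have := LinearMap.finrank_le_finrank_of_injective hinj
    simp at this
    exact_mod_cast this
  refine ⟨ne_top_of_le_ne_top (ENat.natCast_ne_top _) key, ?_⟩
  have := ENat.toNat_le_of_le_natCast key
  refine le_trans ?_ hT
  exact_mod_cast this


/-! ### Boxes and annuli -/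

def bbox {d : ℕ} (r : ℝ) : Set (Ed d) := {x | ∀ i, -r ≤ x i ∧ x i < r}

lemma measurableSet_bbox {d : ℕ} (r : ℝ) : MeasurableSet (bbox (d := d) r) := by
  have : bbox (d := d) r = ⋂ i, {x : Ed d | -r ≤ x i ∧ x i < r} := by
    ext x; simp [bbox]
  rw [this]
  refine MeasurableSet.iInter fun i => ?_
  have hm : Measurable fun x : Ed d => x i := by fun_prop
  exact (measurableSet_le measurable_const hm).inter (measurableSet_lt hm measurable_const)

lemma mem_gcube_iff {d : ℕ} {l : ℝ} (hl : 0 < l) (n : Fin d → ℤ) (x : Ed d) :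
    x ∈ gcube l n ↔ (fun i => ⌊x i / l⌋) = n := by
  rw [funext_iff]
  refine forall_congr' fun i => ?_
  rw [Int.floor_eq_iff, le_div_iff₀ hl, div_lt_iff₀ hl, mul_comm l, mul_comm l]

lemma gcube_disjoint {d : ℕ} {l : ℝ} (hl : 0 < l) (n n' : Fin d → ℤ) (h : n ≠ n') :
    Disjoint (gcube l n) (gcube l n') := by
  rw [Set.disjoint_left]
  intro x hx hx'
  rw [mem_gcube_iff hl] at hx hx'
  exact h (hx.symm.trans hx')

def boxIdx (d : ℕ) (m : ℕ) : Finset (Fin d → ℤ) :=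
  Fintype.piFinset (fun _ => Finset.Ico (-(m:ℤ)) m)

def annIdx (d : ℕ) (m K : ℕ) : Finset (Fin d → ℤ) := boxIdx d K \ boxIdx d m

lemma boxIdx_card (d m : ℕ) : (boxIdx d m).card = (2 * m) ^ d := by
  simp only [boxIdx, Fintype.card_piFinset, Int.card_Ico, Finset.prod_const, Finset.card_univ,
    Fintype.card_fin]
  congr 1
  omega

lemma annIdx_card_le (d m K : ℕ) : (annIdx d m K).card ≤ (2 * K) ^ d := by
  rw [← boxIdx_card]
  exact Finset.card_le_card Finset.sdiff_subset

lemma mem_bbox_iff {d : ℕ} {l : ℝ} (hl : 0 < l) (m : ℕ) (x : Ed d) :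
    x ∈ bbox (m * l) ↔ (fun i => ⌊x i / l⌋) ∈ boxIdx d m := by
  simp only [boxIdx, Fintype.mem_piFinset, Finset.mem_Ico]
  refine forall_congr' fun i => ?_
  rw [Int.le_floor, Int.floor_lt, le_div_iff₀ hl, div_lt_iff₀ hl]
  push_cast
  rw [neg_mul]

lemma bbox_decomp {d : ℕ} {l : ℝ} (hl : 0 < l) {m K : ℕ} (hmK : m ≤ K) :
    bbox (d := d) (K * l) = bbox (m * l) ∪ ⋃ n ∈ annIdx d m K, gcube l n := by
  ext x
  have hsub : boxIdx d m ⊆ boxIdx d K := by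
    intro n
    simp only [boxIdx, Fintype.mem_piFinset, Finset.mem_Ico]
    intro h i
    have := h i
    omega
  simp only [mem_union, mem_iUnion, mem_gcube_iff hl, mem_bbox_iff hl, annIdx, Finset.mem_sdiff,
    exists_prop]
  constructor
  · intro h
    by_cases h' : (fun i => ⌊x i / l⌋) ∈ boxIdx d m
    · exact Or.inl h'
    · exact Or.inr ⟨_, ⟨h, h'⟩, rfl⟩
  · rintro (h | ⟨n, hn, rfl⟩)
    · exact hsub h
    · exact hn.1

lemma bbox_ann_disjoint {d : ℕ} {l : ℝ} (hl : 0 < l) {m K : ℕ} :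
    Disjoint (bbox (d := d) (m * l)) (⋃ n ∈ annIdx d m K, gcube l n) := by
  rw [Set.disjoint_left]
  intro x hx hx'
  simp only [mem_iUnion, mem_gcube_iff hl, annIdx, Finset.mem_sdiff, exists_prop] at hx'
  obtain ⟨n, hn, rfl⟩ := hx'
  exact hn.2 ((mem_bbox_iff hl m x).mp hx)

lemma measurableSet_ann {d : ℕ} {l : ℝ} {m K : ℕ} :
    MeasurableSet (⋃ n ∈ annIdx d m K, gcube l n) :=
  Finset.measurableSet_biUnion _ fun n _ => measurableSet_gcube l n

lemma norm_ge_of_not_bbox {d : ℕ} {r : ℝ} (x : Ed d) (hx : x ∉ bbox r) : r ≤ ‖x‖ := by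
  simp only [bbox, mem_ofPred_eq, not_forall, not_and_or, not_le, not_lt] at hx
  obtain ⟨i, hi⟩ := hx
  have h := PiLp.norm_apply_le x i
  rw [Real.norm_eq_abs] at h
  rcases hi with hi | hi
  · have := neg_abs_le (x i); linarith
  · have := le_abs_self (x i); linarith

lemma norm_ge_of_ann {d : ℕ} {l : ℝ} (hl : 0 < l) {m K : ℕ} {n : Fin d → ℤ}
    (hn : n ∈ annIdx d m K) {x : Ed d} (hx : x ∈ gcube l n) : m * l ≤ ‖x‖ := by
  refine norm_ge_of_not_bbox x fun h => ?_
  rw [mem_gcube_iff hl] at hx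
  rw [mem_bbox_iff hl, hx] at h
  exact (Finset.mem_sdiff.mp hn).2 h

lemma cnt0_crude (d : ℕ) (lam : ℝ) : (cnt0 d lam : ℝ) ≤ (1 + sqrt lam) ^ d := by
  have hsub : cntSet d lam ⊆ ((Fintype.piFinset fun _ : Fin d => Finset.range (⌊sqrt lam⌋₊ + 1) :
      Finset (Fin d → ℕ)) : Set (Fin d → ℕ)) := by
    intro k hk
    simp only [Finset.mem_coe, Fintype.mem_piFinset, Finset.mem_range]
    intro i
    have hk' : ∑ i, (π * k i) ^ 2 < lam := hk
    have h1 : (π * k i) ^ 2 ≤ ∑ i, (π * (k i : ℝ)) ^ 2 :=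
      Finset.single_le_sum (f := fun i => (π * (k i : ℝ)) ^ 2) (fun i _ => sq_nonneg _)
        (Finset.mem_univ i)
    have h2 : (k i : ℝ) ≤ sqrt lam := by
      apply Real.le_sqrt_of_sq_le
      have h3 : (1:ℝ) ≤ π := by linarith [pi_gt_three]
      have h4 : (k i : ℝ) ^ 2 ≤ (π * k i) ^ 2 := by
        apply pow_le_pow_left₀ (by positivity)
        nlinarith [Nat.cast_nonneg (α := ℝ) (k i)]
      linarith
    exact Nat.lt_succ_of_le (Nat.le_floor h2)
  have h := Set.ncard_le_ncard hsub (Finset.finite_toSet _)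
  rw [Set.ncard_coe_finset, Fintype.card_piFinset] at h
  simp only [Finset.card_range, Finset.prod_const, Finset.card_univ, Fintype.card_fin] at h
  calc (cnt0 d lam : ℝ) ≤ ((⌊sqrt lam⌋₊ + 1 : ℕ) : ℝ) ^ d := by
        unfold cnt0; exact_mod_cast h
    _ ≤ _ := by
        apply pow_le_pow_left₀ (by positivity)
        push_cast
        linarith [Nat.floor_le (sqrt_nonneg lam)]

/-- One annulus step. -/
lemma good_ann {d : ℕ} {l : ℝ} (hl : 0 < l) {m K : ℕ} (hmK : m ≤ K) {W : Ed d → ℝ}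
    (hW : Continuous W) {a : ℝ} (h0 : Good (bbox (m * l)) W a) (c : (Fin d → ℤ) → ℝ)
    (hc : ∀ n ∈ annIdx d m K, ∀ x ∈ gcube l n, - c n ≤ W x) :
    Good (bbox (K * l)) W (a + ∑ n ∈ annIdx d m K, (cnt0 d (l ^ 2 * c n) : ℝ)) := by
  rw [bbox_decomp hl hmK]
  refine good_union hW (bbox_ann_disjoint hl) measurableSet_ann h0 ?_
  exact good_biUnion _ _ _ hW (fun n => measurableSet_gcube l n) (gcube_disjoint hl)
    fun n hn => good_gcube hl n W hW _ (hc n hn)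

lemma good_core_pow {d : ℕ} (hd : 1 ≤ d) {ρ C : ℝ} (hρ : ρ ∈ Ioo (0:ℝ) 2) (hC : 0 < C) :
    ∃ K0 : ℝ, 0 < K0 ∧ ∀ W : Ed d → ℝ, Continuous W →
      (∀ x, - (C * (1 + ‖x‖) ^ (-ρ)) ≤ W x) → ∀ j : ℕ, ∀ r : ℝ, 0 < r → r ≤ 2 ^ j →
      Good (bbox r) W (K0 * (((2:ℝ) ^ (1 - ρ / 2)) ^ d) ^ j) := by
  set b : ℝ := (2:ℝ) ^ (1 - ρ / 2) with hb
  have hb1 : 1 < b := Real.one_lt_rpow (by norm_num) (by linarith [hρ.2])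
  have hB1 : 1 < b ^ d := one_lt_pow₀ hb1 (by omega)
  set A : ℝ := 4 ^ d * (1 + sqrt C) ^ d with hA
  have hA0 : 0 < A := by positivity
  have hBp : 0 < b ^ d - 1 := by linarith
  refine ⟨A / (b ^ d - 1) + A, by positivity, fun W hW hWb j => ?_⟩
  induction j with
  | zero =>
    intro r hr hr1
    have hr1 : r ≤ 1 := by simpa using hr1
    have h0 : Good (d := d) (bbox ((0:ℕ) * r)) W 0 := by
      refine good_nonneg (measurableSet_bbox _) fun x hx => ?_
      have := hx ⟨0, hd⟩
      simp at this
      linarith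
    have h1 := good_ann hr (m := 0) (K := 1) (by norm_num) hW h0 (fun _ => C) (by
      intro n _ x _
      refine le_trans ?_ (hWb x)
      have : (1 + ‖x‖) ^ (-ρ) ≤ 1 :=
        Real.rpow_le_one_of_one_le_of_nonpos (by linarith [norm_nonneg x]) (by linarith [hρ.1])
      nlinarith)
    rw [Nat.cast_one, one_mul] at h1
    refine good_mono h1 ?_
    rw [Finset.sum_const, nsmul_eq_mul]
    have e1 : ((annIdx d 0 1).card : ℝ) ≤ 4 ^ d := by
      have : ((annIdx d 0 1).card : ℝ) ≤ ((2 * 1) ^ d : ℕ) := by exact_mod_cast annIdx_card_le d 0 1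
      refine this.trans ?_
      push_cast
      apply pow_le_pow_left₀ <;> norm_num
    have e2 : (cnt0 d (r ^ 2 * C) : ℝ) ≤ (1 + sqrt C) ^ d := by
      refine (cnt0_crude _ _).trans ?_
      apply pow_le_pow_left₀ (by positivity)
      gcongr
      have : r ^ 2 ≤ 1 := by nlinarith
      nlinarith
    have e3 : ((annIdx d 0 1).card : ℝ) * (cnt0 d (r ^ 2 * C) : ℝ) ≤ A := by
      rw [hA]; gcongr
    have : 0 < A / (b ^ d - 1) := by positivity
    simp only [pow_zero, mul_one]
    linarith
  | succ j ih =>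
    intro r hr hr1
    set l : ℝ := r / 2 with hl
    have hl0 : 0 < l := by positivity
    have hl1 : l ≤ 2 ^ j := by rw [pow_succ] at hr1; linarith
    have h0 : Good (d := d) (bbox ((1:ℕ) * l)) W ((A / (b ^ d - 1) + A) * (b ^ d) ^ j) := by
      rw [Nat.cast_one, one_mul]; exact ih l hl0 hl1
    have h1 := good_ann hl0 (m := 1) (K := 2) (by norm_num) hW h0 (fun _ => C * l ^ (-ρ)) (by
      intro n hn x hx
      refine le_trans ?_ (hWb x)
      have hx' := norm_ge_of_ann hl0 hn hx
      have : (1 + ‖x‖) ^ (-ρ) ≤ l ^ (-ρ) := by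
        apply Real.rpow_le_rpow_of_nonpos hl0
        · push_cast at hx'; linarith
        · linarith [hρ.1]
      nlinarith)
    have hrl : ((2:ℕ):ℝ) * l = r := by rw [hl]; push_cast; ring
    rw [hrl] at h1
    refine good_mono h1 ?_
    rw [Finset.sum_const, nsmul_eq_mul]
    have e1 : ((annIdx d 1 2).card : ℝ) ≤ 4 ^ d := by
      have : ((annIdx d 1 2).card : ℝ) ≤ ((2 * 2) ^ d : ℕ) := by exact_mod_cast annIdx_card_le d 1 2
      refine this.trans ?_
      push_cast
      apply pow_le_pow_left₀ <;> norm_num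
    have hbj : 1 ≤ b ^ j := one_le_pow₀ hb1.le
    have e2 : (cnt0 d (l ^ 2 * (C * l ^ (-ρ))) : ℝ) ≤ (1 + sqrt C) ^ d * (b ^ d) ^ j := by
      refine (cnt0_crude _ _).trans ?_
      rw [← pow_mul, mul_comm d j, pow_mul, ← mul_pow]
      apply pow_le_pow_left₀ (by positivity)
      have : sqrt (l ^ 2 * (C * l ^ (-ρ))) ≤ sqrt C * b ^ j := by
        rw [← Real.sqrt_sq (by positivity : 0 ≤ b ^ j), ← Real.sqrt_mul hC.le]
        apply Real.sqrt_le_sqrt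
        have h3 : l ^ 2 * (C * l ^ (-ρ)) = C * l ^ (2 - ρ) := by
          rw [show (2 - ρ) = 2 + (-ρ) by ring, Real.rpow_add hl0, Real.rpow_two]; ring
        have h4 : (b ^ j) ^ 2 = ((2:ℝ) ^ j) ^ (2 - ρ) := by
          rw [hb, ← Real.rpow_natCast, ← Real.rpow_natCast, ← Real.rpow_mul (by positivity),
            ← Real.rpow_mul (by positivity), ← Real.rpow_natCast, ← Real.rpow_mul (by positivity)]
          congr 1
          push_cast
          ring
        rw [h3, h4]
        have : l ^ (2 - ρ) ≤ ((2:ℝ) ^ j) ^ (2 - ρ) :=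
          Real.rpow_le_rpow hl0.le hl1 (by linarith [hρ.2])
        gcongr
      nlinarith
    have e3 : ((annIdx d 1 2).card : ℝ) * (cnt0 d (l ^ 2 * (C * l ^ (-ρ))) : ℝ)
        ≤ A * (b ^ d) ^ j := by
      rw [hA, mul_assoc]; gcongr
    have hBj : 0 < (b ^ d) ^ j := by positivity
    calc _ ≤ (A / (b ^ d - 1) + A) * (b ^ d) ^ j + A * (b ^ d) ^ j := by linarith
      _ = (A / (b ^ d - 1) + 2 * A) * (b ^ d) ^ j := by ring
      _ ≤ ((A / (b ^ d - 1) + A) * b ^ d) * (b ^ d) ^ j := by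
          gcongr
          have : (A / (b ^ d - 1) + A) * b ^ d = A / (b ^ d - 1) + A +
            (A / (b ^ d - 1) + A) * (b ^ d - 1) := by ring
          rw [this, add_mul, div_mul_cancel₀ _ hBp.ne']
          nlinarith
      _ = _ := by rw [pow_succ]; ring

lemma good_core {d : ℕ} (hd : 1 ≤ d) {ρ C : ℝ} (hρ : ρ ∈ Ioo (0:ℝ) 2) (hC : 0 < C) :
    ∃ K0 : ℝ, 0 < K0 ∧ ∀ W : Ed d → ℝ, Continuous W →
      (∀ x, - (C * (1 + ‖x‖) ^ (-ρ)) ≤ W x) → ∀ r : ℝ, 1 ≤ r →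
      Good (bbox r) W (K0 * (r ^ (1 - ρ / 2)) ^ d) := by
  obtain ⟨K0, hK0, h⟩ := good_core_pow hd hρ hC
  refine ⟨K0 * ((2:ℝ) ^ (1 - ρ / 2)) ^ d, by positivity, fun W hW hWb r hr => ?_⟩
  obtain ⟨n, hn1, hn2⟩ := exists_nat_pow_near hr (by norm_num : (1:ℝ) < 2)
  refine good_mono (h W hW hWb (n + 1) r (by linarith) hn2.le) ?_
  rw [pow_succ' _ n, ← mul_assoc]
  gcongr
  rw [← pow_mul, mul_comm d n, pow_mul]
  gcongr
  rw [← Real.rpow_natCast, ← Real.rpow_mul (by norm_num), mul_comm, Real.rpow_mul (by norm_num),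
    Real.rpow_natCast]
  exact Real.rpow_le_rpow (by positivity) hn1 (by linarith [hρ.2])


/-! ### One dimensional Dirichlet test functions -/

lemma dS_zero {x : ℝ} (hx : x < 0 ∨ 1 < x) : deriv smoothTransition x = 0 := by
  rcases hx with h | h
  · have : smoothTransition =ᶠ[𝓝 x] fun _ => 0 := by
      filter_upwards [gt_mem_nhds h] with y hy
      exact smoothTransition.zero_of_nonpos (le_of_lt hy)
    rw [this.deriv_eq]; simp
  · have : smoothTransition =ᶠ[𝓝 x] fun _ => 1 := by
      filter_upwards [lt_mem_nhds h] with y hy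
      exact smoothTransition.one_of_one_le (le_of_lt hy)
    rw [this.deriv_eq]; simp

lemma dS_cont : Continuous (deriv smoothTransition) :=
  (smoothTransition.contDiff (n := 1)).continuous_deriv (by norm_num)

lemma dS_has (x : ℝ) : HasDerivAt smoothTransition (deriv smoothTransition x) x :=
  ((smoothTransition.contDiff (n := 1)).differentiable (by norm_num) x).hasDerivAt

lemma dS_bound : ∃ M : ℝ, 0 ≤ M ∧ ∀ x, |deriv smoothTransition x| ≤ M := by
  obtain ⟨M, hM⟩ := (isCompact_Icc (a := (0:ℝ)) (b := 1)).exists_bound_of_continuousOn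
    dS_cont.continuousOn
  refine ⟨|M|, abs_nonneg _, fun x => ?_⟩
  by_cases hx : x ∈ Icc (0:ℝ) 1
  · exact (hM x hx).trans (le_abs_self _)
  · rw [dS_zero]
    · simp
    · by_contra hc
      push Not at hc
      exact hx ⟨hc.1, hc.2⟩

def psi (N : ℝ) (k : ℕ) (t : ℝ) : ℝ :=
  sin (π * k * t) * (smoothTransition (N * t - 1) * smoothTransition (N * (1 - t) - 1))

def dpsi (N : ℝ) (k : ℕ) (t : ℝ) : ℝ :=
  π * k * cos (π * k * t) * (smoothTransition (N * t - 1) * smoothTransition (N * (1 - t) - 1)) +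
  sin (π * k * t) * (N * deriv smoothTransition (N * t - 1) * smoothTransition (N * (1 - t) - 1)
    - smoothTransition (N * t - 1) * (N * deriv smoothTransition (N * (1 - t) - 1)))

lemma psi_contDiff (N : ℝ) (k : ℕ) {n : ℕ∞} : ContDiff ℝ n (psi N k) := by
  unfold psi
  refine ContDiff.mul (by fun_prop) (ContDiff.mul ?_ ?_)
  · exact smoothTransition.contDiff.comp (by fun_prop)
  · exact smoothTransition.contDiff.comp (by fun_prop)

lemma psi_hasDeriv (N : ℝ) (k : ℕ) (t : ℝ) : HasDerivAt (psi N k) (dpsi N k t) t := by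
  have h1 : HasDerivAt (fun t : ℝ => sin (π * k * t)) (π * k * cos (π * k * t)) t := by
    have := ((hasDerivAt_id t).const_mul (π * k)).sin
    simpa [mul_comm] using this
  have h2 : HasDerivAt (fun t : ℝ => smoothTransition (N * t - 1))
      (N * deriv smoothTransition (N * t - 1)) t := by
    have h := ((hasDerivAt_id t).const_mul N).sub_const 1
    have := HasDerivAt.comp t (dS_has (N * id t - 1)) h
    simpa [mul_comm, Function.comp_def] using this
  have h3 : HasDerivAt (fun t : ℝ => smoothTransition (N * (1 - t) - 1))
      (- (N * deriv smoothTransition (N * (1 - t) - 1))) t := by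
    have h := (((hasDerivAt_id t).const_sub 1).const_mul N).sub_const 1
    have := HasDerivAt.comp t (dS_has (N * (1 - id t) - 1)) h
    simpa [mul_comm, Function.comp_def] using this
  have := h1.mul (h2.mul h3)
  refine HasDerivAt.congr_deriv (f := psi N k) this ?_
  unfold dpsi
  simp only [Pi.mul_apply, mul_neg]
  ring

lemma dpsi_cont (N : ℝ) (k : ℕ) : Continuous (dpsi N k) := by
  unfold dpsi
  have := dS_cont
  have := smoothTransition.continuous
  fun_prop

lemma psi_bound (N : ℝ) (k : ℕ) (t : ℝ) : |psi N k t| ≤ 1 := by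
  unfold psi
  rw [abs_mul, abs_mul, abs_of_nonneg (smoothTransition.nonneg _),
    abs_of_nonneg (smoothTransition.nonneg _)]
  have := abs_sin_le_one (π * k * t)
  have h1 := smoothTransition.nonneg (N * t - 1)
  have h2 := smoothTransition.nonneg (N * (1 - t) - 1)
  have h3 := smoothTransition.le_one (N * t - 1)
  have h4 := smoothTransition.le_one (N * (1 - t) - 1)
  calc _ ≤ 1 * (1 * 1 : ℝ) := by gcongr
    _ = 1 := by norm_num

lemma abs_sin_flip (k : ℕ) (t : ℝ) : |sin (π * k * t)| = |sin (π * k * (1 - t))| := by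
  have : π * k * (1 - t) = k * π - π * k * t := by ring
  rw [this, sin_nat_mul_pi_sub, abs_neg, abs_mul]
  simp

lemma dpsi_bound (k : ℕ) : ∃ B : ℝ, ∀ N : ℝ, 0 < N → ∀ t ∈ Icc (0:ℝ) 1, |dpsi N k t| ≤ B := by
  obtain ⟨M, hM0, hM⟩ := dS_bound
  refine ⟨π * k + (2 * π * k * M + 2 * π * k * M), fun N hN t ht => ?_⟩
  have h1 := smoothTransition.nonneg (N * t - 1)
  have h2 := smoothTransition.nonneg (N * (1 - t) - 1)
  have h3 := smoothTransition.le_one (N * t - 1)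
  have h4 := smoothTransition.le_one (N * (1 - t) - 1)
  have key : ∀ s : ℝ, 0 ≤ s → |sin (π * k * s)| * (N * |deriv smoothTransition (N * s - 1)|)
      ≤ 2 * π * k * M := by
    intro s hs
    by_cases h : 1 < N * s - 1
    · rw [dS_zero (Or.inr h)]; simp; positivity
    · push Not at h
      have e1 : |sin (π * k * s)| ≤ π * k * s := by
        refine (abs_sin_le_abs).trans ?_
        rw [abs_of_nonneg (by positivity)]
      calc _ ≤ (π * k * s) * (N * M) := by
            gcongr; exact hM _
        _ = π * k * M * (N * s) := by ring
        _ ≤ π * k * M * 2 := by gcongr; linarith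
        _ = _ := by ring
  have a1 := key t ht.1
  have a2 := key (1 - t) (by linarith [ht.2])
  rw [← abs_sin_flip] at a2
  have b1 : |π * k * cos (π * k * t) * (smoothTransition (N * t - 1) *
      smoothTransition (N * (1 - t) - 1))| ≤ π * k := by
    rw [abs_mul, abs_mul (π * (k:ℝ)), abs_mul (smoothTransition _), abs_of_nonneg h1,
      abs_of_nonneg h2, abs_of_nonneg (by positivity : 0 ≤ π * (k:ℝ))]
    calc _ ≤ π * k * 1 * (1 * 1) := by
          gcongr; exact abs_cos_le_one _
      _ = _ := by ring
  have b2 : |sin (π * k * t) * (N * deriv smoothTransition (N * t - 1) *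
      smoothTransition (N * (1 - t) - 1))| ≤ 2 * π * k * M := by
    rw [abs_mul, abs_mul, abs_mul, abs_of_pos hN, abs_of_nonneg h2]
    calc _ ≤ |sin (π * k * t)| * (N * |deriv smoothTransition (N * t - 1)| * 1) := by gcongr
      _ ≤ _ := by rw [mul_one]; exact a1
  have b3 : |sin (π * k * t) * (smoothTransition (N * t - 1) *
      (N * deriv smoothTransition (N * (1 - t) - 1)))| ≤ 2 * π * k * M := by
    rw [abs_mul, abs_mul, abs_mul, abs_of_pos hN, abs_of_nonneg h1]
    calc _ ≤ |sin (π * k * t)| * (1 * (N * |deriv smoothTransition (N * (1 - t) - 1)|)) := by gcongr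
      _ ≤ _ := by rw [one_mul]; exact a2
  unfold dpsi
  rw [mul_sub (sin _)]
  refine (abs_add_le _ _).trans (add_le_add b1 ((abs_sub _ _).trans (add_le_add b2 b3)))

lemma psi_supp {N : ℝ} (hN : 0 < N) (k : ℕ) (t : ℝ) (h : psi N k t ≠ 0) :
    N⁻¹ < t ∧ t < 1 - N⁻¹ := by
  unfold psi at h
  have h' := right_ne_zero_of_mul h
  have h1 := left_ne_zero_of_mul h'
  have h2 := right_ne_zero_of_mul h'
  rw [Ne, smoothTransition.zero_iff_nonpos, not_le] at h1 h2
  rw [inv_lt_iff_one_lt_mul₀ hN]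
  have h3 : N⁻¹ < 1 - t := by rw [inv_lt_iff_one_lt_mul₀ hN]; linarith
  exact ⟨by linarith, by linarith⟩

lemma Icc_ae_Ioo : ∀ᵐ t ∂(volume.restrict (Icc (0:ℝ) 1)), t ∈ Ioo (0:ℝ) 1 := by
  rw [← restrict_Ioo_eq_restrict_Icc]
  exact ae_restrict_mem measurableSet_Ioo

lemma ev_large {t : ℝ} (ht : t ∈ Ioo (0:ℝ) 1) :
    ∀ᶠ n : ℕ in atTop, 1 < (n + 3 : ℝ) * t - 1 ∧ 1 < (n + 3 : ℝ) * (1 - t) - 1 := by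
  have h1 : Tendsto (fun n : ℕ => (n + 3 : ℝ) * t) atTop atTop :=
    (tendsto_natCast_atTop_atTop.atTop_add tendsto_const_nhds).atTop_mul_const ht.1
  have h2 : Tendsto (fun n : ℕ => (n + 3 : ℝ) * (1 - t)) atTop atTop :=
    (tendsto_natCast_atTop_atTop.atTop_add tendsto_const_nhds).atTop_mul_const (by linarith [ht.2])
  filter_upwards [h1.eventually_gt_atTop 2, h2.eventually_gt_atTop 2] with n a b
  exact ⟨by linarith, by linarith⟩

lemma psi_gram (k l : ℕ) (hk : 0 < k) : Tendsto (fun n : ℕ => ∫ t in Icc (0:ℝ) 1,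
    psi (n + 3) k t * psi (n + 3) l t) atTop (𝓝 (if k = l then 1 / 2 else 0)) := by
  have h0 := int_sin_sin k l
  simp only [hk.ne', if_false] at h0
  rw [← h0]
  refine tendsto_integral_of_dominated_convergence (fun _ => (1:ℝ)) ?_ ?_ ?_ ?_
  · intro n
    exact ((psi_contDiff (n := 0) _ _).continuous.mul
      (psi_contDiff (n := 0) _ _).continuous).aestronglyMeasurable
  · exact integrable_const _
  · intro n
    refine Eventually.of_forall fun t => ?_
    rw [norm_mul, Real.norm_eq_abs, Real.norm_eq_abs]
    have := psi_bound (n + 3) k t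
    have := psi_bound (n + 3) l t
    nlinarith [abs_nonneg (psi (n + 3) k t), abs_nonneg (psi (n + 3) l t)]
  · filter_upwards [Icc_ae_Ioo] with t ht
    refine tendsto_const_nhds.congr' ?_
    filter_upwards [ev_large ht] with n hn
    simp only [psi, smoothTransition.one_of_one_le hn.1.le, smoothTransition.one_of_one_le hn.2.le,
      mul_one]

lemma psi_energy (k l : ℕ) (hk : 0 < k) : Tendsto (fun n : ℕ => ∫ t in Icc (0:ℝ) 1,
    dpsi (n + 3) k t * dpsi (n + 3) l t) atTop (𝓝 (if k = l then (π * k) ^ 2 * (1 / 2) else 0)) := by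
  have h0 : ∫ t in Icc (0:ℝ) 1, (π * k * cos (π * k * t)) * (π * l * cos (π * l * t)) =
      if k = l then (π * k) ^ 2 * (1 / 2) else 0 := by
    have : ∀ t : ℝ, (π * k * cos (π * k * t)) * (π * l * cos (π * l * t)) =
      (π * k) * (π * l) * (cos (π * k * t) * cos (π * l * t)) := fun t => by ring
    simp_rw [this]
    rw [integral_const_mul, int_cos_cos]
    split_ifs with h1 h2
    · omega
    · rw [← h1]; ring
    · simp
  rw [← h0]
  obtain ⟨B, hB⟩ := dpsi_bound k
  obtain ⟨B', hB'⟩ := dpsi_bound l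
  refine tendsto_integral_of_dominated_convergence (fun _ => B * B') ?_ ?_ ?_ ?_
  · intro n
    exact ((dpsi_cont _ _).mul (dpsi_cont _ _)).aestronglyMeasurable
  · exact integrable_const _
  · intro n
    filter_upwards [ae_restrict_mem measurableSet_Icc] with t ht
    rw [norm_mul, Real.norm_eq_abs, Real.norm_eq_abs]
    have h1 := hB (n + 3) (by positivity) t ht
    have h2 := hB' (n + 3) (by positivity) t ht
    have := (abs_nonneg _).trans h1
    gcongr
  · filter_upwards [Icc_ae_Ioo] with t ht
    refine tendsto_const_nhds.congr' ?_
    filter_upwards [ev_large ht] with n hn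
    simp only [dpsi, smoothTransition.one_of_one_le hn.1.le, smoothTransition.one_of_one_le hn.2.le,
      dS_zero (Or.inr hn.1), dS_zero (Or.inr hn.2)]
    ring


/-! ### Multi-dimensional Dirichlet test functions -/

lemma neg_def_perturb {ι : Type*} [Fintype ι] [DecidableEq ι] (Q : ℕ → ι → ι → ℝ) (D : ι → ℝ)
    (hD : ∀ i, D i < 0)
    (hQ : ∀ i j, Tendsto (fun n => Q n i j) atTop (𝓝 (if i = j then D i else 0))) :
    ∃ n, ∀ c : ι → ℝ, c ≠ 0 → ∑ i, ∑ j, c i * c j * Q n i j < 0 := by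
  obtain ⟨δ, hδ, hδD⟩ : ∃ δ : ℝ, 0 < δ ∧ ∀ i, D i ≤ -δ := by
    rcases isEmpty_or_nonempty ι with h | h
    · exact ⟨1, one_pos, fun i => h.elim i⟩
    · obtain ⟨i0, hi0⟩ := Finite.exists_max D
      exact ⟨- D i0, by linarith [hD i0], fun i => by linarith [hi0 i]⟩
  set e : ℝ := δ / (2 * (Fintype.card ι + 1)) with he
  have he0 : 0 < e := by positivity
  have hev : ∀ᶠ n in atTop, ∀ i j, |Q n i j - (if i = j then D i else 0)| < e := by
    rw [eventually_all]; intro i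
    rw [eventually_all]; intro j
    have := (hQ i j).eventually (Metric.ball_mem_nhds _ he0)
    filter_upwards [this] with n hn
    simpa [Real.dist_eq] using hn
  obtain ⟨n, hn⟩ := hev.exists
  refine ⟨n, fun c hc => ?_⟩
  have hpos : 0 < ∑ i, c i ^ 2 := by
    obtain ⟨i, hi⟩ := Function.ne_iff.mp hc
    have hi' : c i ≠ 0 := hi
    refine Finset.sum_pos' (fun i _ => sq_nonneg _) ⟨i, Finset.mem_univ _, by positivity⟩
  have h1 : ∀ i j, c i * c j * Q n i j ≤ (if i = j then c i * c j * D i else 0)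
      + (c i ^ 2 + c j ^ 2) / 2 * e := by
    intro i j
    have h2 : c i * c j * Q n i j = c i * c j * (if i = j then D i else 0) +
      c i * c j * (Q n i j - (if i = j then D i else 0)) := by ring
    have h3 : c i * c j * (Q n i j - (if i = j then D i else 0)) ≤ (c i ^ 2 + c j ^ 2) / 2 * e := by
      refine (le_abs_self _).trans ?_
      rw [abs_mul]
      have h4 : |c i * c j| ≤ (c i ^ 2 + c j ^ 2) / 2 := by
        rw [abs_le]; constructor <;> nlinarith [sq_nonneg (c i - c j), sq_nonneg (c i + c j)]
      gcongr
      exact (hn i j).le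
    rw [h2]
    split_ifs with h
    · simp only [h, if_true] at h3 ⊢; linarith
    · simp only [h, if_false] at h3 ⊢; linarith
  have hs : ∑ i, ∑ j, (c i ^ 2 + c j ^ 2) / 2 * e = (∑ i, c i ^ 2) * (Fintype.card ι) * e := by
    simp_rw [← Finset.sum_mul, ← Finset.sum_div, Finset.sum_add_distrib, Finset.sum_const,
      Finset.card_univ, nsmul_eq_mul, ← Finset.mul_sum]
    ring
  calc ∑ i, ∑ j, c i * c j * Q n i j
      ≤ ∑ i, ∑ j, ((if i = j then c i * c j * D i else 0) + (c i ^ 2 + c j ^ 2) / 2 * e) :=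
        Finset.sum_le_sum fun i _ => Finset.sum_le_sum fun j _ => h1 i j
    _ = ∑ i, c i * c i * D i + (∑ i, c i ^ 2) * (Fintype.card ι) * e := by
        simp_rw [Finset.sum_add_distrib]
        rw [← hs]
        congr 1
        simp
    _ ≤ ∑ i, c i ^ 2 * (-δ) + (∑ i, c i ^ 2) * (Fintype.card ι) * e := by
        refine add_le_add (Finset.sum_le_sum fun i _ => ?_) le_rfl
        nlinarith [hδD i, sq_nonneg (c i)]
    _ = (∑ i, c i ^ 2) * (Fintype.card ι * e - δ) := by rw [← Finset.sum_mul]; ring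
    _ < 0 := by
        apply mul_neg_of_pos_of_neg hpos
        have : e * (2 * (Fintype.card ι + 1)) = δ := by rw [he]; field_simp
        have : (0:ℝ) ≤ Fintype.card ι := by positivity
        nlinarith

def phiP {d : ℕ} (N : ℝ) (k : Fin d → ℕ) (y : Fin d → ℝ) : ℝ := ∏ i, psi N (k i) (y i)

def dphiP {d : ℕ} (N : ℝ) (i : Fin d) (k : Fin d → ℕ) (y : Fin d → ℝ) : ℝ :=
  ∏ j, (if j = i then dpsi N (k j) (y j) else psi N (k j) (y j))

lemma phiP_contDiff {d : ℕ} (N : ℝ) (k : Fin d → ℕ) {n : ℕ∞} : ContDiff ℝ n (phiP N k) := by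
  unfold phiP
  exact contDiff_prod fun i _ => (psi_contDiff N (k i)).comp (by fun_prop)

lemma phiP_cont {d : ℕ} (N : ℝ) (k : Fin d → ℕ) : Continuous (phiP N k) :=
  (phiP_contDiff (n := 0) N k).continuous

lemma dphiP_cont {d : ℕ} (N : ℝ) (i : Fin d) (k : Fin d → ℕ) : Continuous (dphiP N i k) := by
  unfold dphiP
  refine continuous_finsetProd _ fun j _ => ?_
  split_ifs
  · exact (dpsi_cont _ _).comp (by fun_prop)
  · exact (psi_contDiff (n := 0) _ _).continuous.comp (by fun_prop)

lemma phiP_fderiv {d : ℕ} (N : ℝ) (i : Fin d) (k : Fin d → ℕ) (x : Fin d → ℝ) :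
    fderiv ℝ (phiP N k) x (Pi.single i 1) = dphiP N i k x := by
  have hd : DifferentiableAt ℝ (phiP N k) x :=
    (phiP_contDiff (n := 1) N k).differentiable (by norm_num) x
  have h1 : HasDerivAt (fun t : ℝ => x + t • (Pi.single i 1 : Fin d → ℝ)) (Pi.single i 1) 0 := by
    simpa using ((hasDerivAt_id (0:ℝ)).smul_const (Pi.single i (1:ℝ) : Fin d → ℝ)).const_add x
  have h2 := HasFDerivAt.comp_hasDerivAt (f := fun t : ℝ => x + t • (Pi.single i 1 : Fin d → ℝ))
    (l := phiP N k) (l' := fderiv ℝ (phiP N k) x) 0 (by simpa using hd.hasFDerivAt) h1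
  have h3 : (phiP N k ∘ fun t : ℝ => x + t • (Pi.single i 1 : Fin d → ℝ)) =
      fun t => psi N (k i) (x i + t) * ∏ j ∈ Finset.univ.erase i, psi N (k j) (x j) := by
    funext t
    simp only [Function.comp, phiP]
    rw [← Finset.mul_prod_erase _ _ (Finset.mem_univ i)]
    congr 1
    · simp
    · refine Finset.prod_congr rfl fun j hj => ?_
      have := (Finset.mem_erase.mp hj).1
      simp [this]
  have h4 : HasDerivAt (fun t => psi N (k i) (x i + t) *
      ∏ j ∈ Finset.univ.erase i, psi N (k j) (x j))
      (dpsi N (k i) (x i) * ∏ j ∈ Finset.univ.erase i, psi N (k j) (x j)) 0 := by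
    refine HasDerivAt.mul_const ?_ _
    have h5 : HasDerivAt (psi N (k i)) (dpsi N (k i) (x i)) (x i + 0) := by
      simpa using psi_hasDeriv N (k i) (x i)
    exact h5.comp_const_add (x i) 0
  rw [h3] at h2
  rw [h2.unique h4, dphiP, ← Finset.mul_prod_erase _ _ (Finset.mem_univ i)]
  simp only [if_true]
  congr 1
  refine Finset.prod_congr rfl fun j hj => ?_
  have := (Finset.mem_erase.mp hj).1
  simp [this]

lemma gram_lim {d : ℕ} (k k' : Fin d → ℕ) (hk : ∀ i, 0 < k i) :
    Tendsto (fun n : ℕ => ∫ y in Icc (0 : Fin d → ℝ) 1, phiP (n + 3) k y * phiP (n + 3) k' y)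
      atTop (𝓝 (if k = k' then (1 / 2) ^ d else 0)) := by
  have h1 : ∀ n : ℕ, ∫ y in Icc (0 : Fin d → ℝ) 1, phiP (n + 3) k y * phiP (n + 3) k' y =
      ∏ i, ∫ t in Icc (0:ℝ) 1, psi (n + 3) (k i) t * psi (n + 3) (k' i) t := by
    intro n
    rw [← int_cube_prod]
    simp only [phiP, Finset.prod_mul_distrib]
  simp_rw [h1]
  have h2 : (if k = k' then (1 / 2 : ℝ) ^ d else 0) = ∏ i, (if k i = k' i then (1/2:ℝ) else 0) := by
    split_ifs with h
    · simp [h]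
    · obtain ⟨i, hi⟩ := Function.ne_iff.mp h
      exact (Finset.prod_eq_zero (Finset.mem_univ i) (by simp [hi])).symm
  rw [h2]
  exact tendsto_finsetProd _ fun i _ => psi_gram (k i) (k' i) (hk i)

lemma energy_lim {d : ℕ} (i : Fin d) (k k' : Fin d → ℕ) (hk : ∀ i, 0 < k i) :
    Tendsto (fun n : ℕ => ∫ y in Icc (0 : Fin d → ℝ) 1, dphiP (n + 3) i k y * dphiP (n + 3) i k' y)
      atTop (𝓝 (if k = k' then (π * k i) ^ 2 * (1 / 2) ^ d else 0)) := by
  have h1 : ∀ n : ℕ, ∫ y in Icc (0 : Fin d → ℝ) 1, dphiP (n + 3) i k y * dphiP (n + 3) i k' y =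
      ∏ j, ∫ t in Icc (0:ℝ) 1, (if j = i then dpsi (n + 3) (k j) t * dpsi (n + 3) (k' j) t else
        psi (n + 3) (k j) t * psi (n + 3) (k' j) t) := by
    intro n
    rw [← int_cube_prod]
    congr 1
    funext y
    simp only [dphiP, ← Finset.prod_mul_distrib]
    refine Finset.prod_congr rfl fun j _ => ?_
    split_ifs <;> rfl
  simp_rw [h1]
  have h2 : (if k = k' then (π * k i) ^ 2 * (1 / 2 : ℝ) ^ d else 0) =
      ∏ j, (if j = i then (if k j = k' j then (π * k j) ^ 2 * (1/2:ℝ) else 0) else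
        (if k j = k' j then (1/2:ℝ) else 0)) := by
    split_ifs with h
    · subst h
      have : ∀ j, (if j = i then (if k j = k j then (π * k j) ^ 2 * (1/2:ℝ) else 0) else
        (if k j = k j then (1/2:ℝ) else 0)) = (if j = i then (π * k j) ^ 2 else 1) * (1/2:ℝ) := by
        intro j; split_ifs <;> simp_all
      rw [Finset.prod_congr rfl fun j _ => this j, Finset.prod_mul_distrib]
      simp
    · obtain ⟨j, hj⟩ := Function.ne_iff.mp h
      exact (Finset.prod_eq_zero (Finset.mem_univ j) (by simp [hj])).symm
  rw [h2]
  refine tendsto_finsetProd _ fun j _ => ?_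
  split_ifs with hj h h
  · simpa [h] using psi_energy (k j) (k' j) (hk j)
  · simpa [h] using psi_energy (k j) (k' j) (hk j)
  · simpa [h] using psi_gram (k j) (k' j) (hk j)
  · simpa [h] using psi_gram (k j) (k' j) (hk j)

open Classical in
def pfin (d : ℕ) (lam : ℝ) : Finset (Fin d → ℕ) :=
  (cntSet_finite d lam).toFinset.filter (fun k => ∀ i, 0 < k i)

lemma mem_pfin {d : ℕ} {lam : ℝ} {k : Fin d → ℕ} :
    k ∈ pfin d lam ↔ ∑ i, (π * k i) ^ 2 < lam ∧ ∀ i, 0 < k i := by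
  simp [pfin, cntSet]

def cnt1 (d : ℕ) (lam : ℝ) : ℕ := (pfin d lam).card

lemma int_sq_sum {d : ℕ} {ι : Type*} [Fintype ι] (c : ι → ℝ) (f : ι → (Fin d → ℝ) → ℝ)
    (hf : ∀ i, Continuous (f i)) :
    ∫ y in Icc (0 : Fin d → ℝ) 1, (∑ i, c i * f i y) ^ 2 =
      ∑ i, ∑ j, c i * c j * ∫ y in Icc (0 : Fin d → ℝ) 1, f i y * f j y := by
  have h : ∀ y, (∑ i, c i * f i y) ^ 2 = ∑ i, ∑ j, c i * c j * (f i y * f j y) := by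
    intro y
    rw [sq, Finset.sum_mul_sum]
    refine Finset.sum_congr rfl fun i _ => Finset.sum_congr rfl fun j _ => by ring
  simp_rw [h]
  rw [integral_finsetSum]
  · refine Finset.sum_congr rfl fun i _ => ?_
    rw [integral_finsetSum]
    · refine Finset.sum_congr rfl fun j _ => ?_
      rw [integral_const_mul]
    · intro j _
      have := hf i; have := hf j
      exact (by fun_prop : Continuous fun y => c i * c j * (f i y * f j y)).continuousOn.integrableOn_compact
        isCompact_Icc
  · intro i _
    have := hf
    exact (by fun_prop : Continuous fun y => ∑ j, c i * c j * (f i y * f j y)).continuousOn.integrableOn_compact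
        isCompact_Icc

lemma dir_unit (d : ℕ) (lam : ℝ) : ∃ N : ℝ, 3 ≤ N ∧ ∀ c : pfin d lam → ℝ, c ≠ 0 →
    ∑ i, ∫ y in Icc (0 : Fin d → ℝ) 1, (∑ k, c k * dphiP N i k.1 y) ^ 2 <
      lam * ∫ y in Icc (0 : Fin d → ℝ) 1, (∑ k, c k * phiP N k.1 y) ^ 2 := by
  classical
  obtain ⟨n, hn⟩ := neg_def_perturb (ι := pfin d lam)
    (fun n k k' => ∑ i, (∫ y in Icc (0 : Fin d → ℝ) 1,
        dphiP (n + 3) i k.1 y * dphiP (n + 3) i k'.1 y) -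
      lam * ∫ y in Icc (0 : Fin d → ℝ) 1, phiP (n + 3) k.1 y * phiP (n + 3) k'.1 y)
    (fun k => (∑ i, (π * k.1 i) ^ 2 - lam) * (1 / 2) ^ d)
    (by
      intro k
      have := (mem_pfin.mp k.2).1
      apply mul_neg_of_neg_of_pos (by linarith) (by positivity))
    (by
      intro k k'
      have hk := (mem_pfin.mp k.2).2
      have h := (tendsto_finsetSum Finset.univ fun i _ => energy_lim i k.1 k'.1 hk).sub
        ((gram_lim k.1 k'.1 hk).const_mul lam)
      refine (congrArg (fun z => Tendsto _ atTop (𝓝 z)) ?_).mp h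
      by_cases hkk : k = k'
      · subst hkk
        simp only [if_true]
        rw [← Finset.sum_mul]; ring
      · have : k.1 ≠ k'.1 := fun h => hkk (Subtype.ext h)
        simp [this, hkk])
  refine ⟨n + 3, by linarith [Nat.cast_nonneg (α := ℝ) n], fun c hc => ?_⟩
  have h := hn c hc
  rw [int_sq_sum c _ fun k => phiP_cont _ _]
  simp_rw [int_sq_sum c _ fun k => dphiP_cont _ _ _]
  rw [← sub_neg]
  refine lt_of_eq_of_lt ?_ h
  rw [Finset.sum_comm, Finset.mul_sum, ← Finset.sum_sub_distrib]
  refine Finset.sum_congr rfl fun k _ => ?_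
  rw [Finset.sum_comm, Finset.mul_sum, ← Finset.sum_sub_distrib]
  refine Finset.sum_congr rfl fun k' _ => ?_
  rw [← Finset.mul_sum]; ring


/-! ### Dirichlet bracketing -/

lemma fderiv_zero_of_supp {d : ℕ} {u : Ed d → ℝ} {Z : Set (Ed d)} (hZ : IsClosed Z)
    (h : ∀ x, x ∉ Z → u x = 0) {x : Ed d} (hx : x ∉ Z) : fderiv ℝ u x = 0 := by
  have : u =ᶠ[𝓝 x] fun _ => 0 := by
    filter_upwards [hZ.isOpen_compl.mem_nhds hx] with y hy using h y hy
  rw [this.fderiv_eq]; simp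

lemma grad_zero_of_supp {d : ℕ} {u : Ed d → ℝ} {Z : Set (Ed d)} (hZ : IsClosed Z)
    (h : ∀ x, x ∉ Z → u x = 0) {x : Ed d} (hx : x ∉ Z) : gradient u x = 0 := by
  rw [gradient, fderiv_zero_of_supp hZ h hx, map_zero]

lemma dir_gcube {d : ℕ} {l : ℝ} (hl : 0 < l) (n : Fin d → ℤ) (mu : ℝ) :
    ∃ (f : pfin d (l ^ 2 * mu) → Ed d → ℝ) (Z : Set (Ed d)), IsClosed Z ∧ Z ⊆ gcube l n ∧
      (∀ k, f k ∈ XX d) ∧ (∀ k x, x ∉ Z → f k x = 0) ∧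
      ∀ c : pfin d (l ^ 2 * mu) → ℝ, c ≠ 0 →
        ∫ x, ‖gradient (∑ k, c k • f k) x‖ ^ 2 < mu * ∫ x, (∑ k, c k • f k) x ^ 2 := by
  obtain ⟨N, hN, h⟩ := dir_unit d (l ^ 2 * mu)
  have hN0 : 0 < N := by linarith
  have hNi : 0 < N⁻¹ := by positivity
  let Z : Set (Ed d) := ⋂ i, {x : Ed d | N⁻¹ ≤ x i / l - n i ∧ x i / l - n i ≤ 1 - N⁻¹}
  let f : pfin d (l ^ 2 * mu) → Ed d → ℝ := fun k x => phiP N k.1 (fun i => x i / l - n i)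
  have hZc : IsClosed Z := by
    refine isClosed_iInter fun i => ?_
    have hc : Continuous fun x : Ed d => x i / l - n i := by fun_prop
    exact (isClosed_le continuous_const hc).inter (isClosed_le hc continuous_const)
  have hZg : Z ⊆ gcube l n := by
    intro x hx i
    obtain ⟨h1, h2⟩ := mem_iInter.mp hx i
    have h3 : (n i : ℝ) ≤ x i / l := by linarith
    have h4 : x i / l < n i + 1 := by linarith
    rw [le_div_iff₀ hl] at h3
    rw [div_lt_iff₀ hl] at h4
    exact ⟨by linarith, by linarith⟩
  have hfZ : ∀ k x, x ∉ Z → f k x = 0 := by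
    intro k x hx
    by_contra hne
    apply hx
    refine mem_iInter.mpr fun i => ?_
    have := psi_supp hN0 (k.1 i) _ (Finset.prod_ne_zero_iff.mp hne i (Finset.mem_univ i))
    exact ⟨this.1.le, this.2.le⟩
  have hZK : Z ⊆ aff l n '' Icc 0 1 := by
    intro x hx
    refine ⟨fun i => x i / l - n i, ⟨fun i => ?_, fun i => ?_⟩, ?_⟩
    · have := (mem_iInter.mp hx i).1
      simp only [Pi.zero_apply]; linarith
    · have := (mem_iInter.mp hx i).2
      simp only [Pi.one_apply]; linarith
    · ext i
      simp only [aff]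
      field_simp
      ring
  have hcp : IsCompact (aff (d := d) l n '' Icc 0 1) :=
    isCompact_Icc.image (aff_contDiff (k := 0) l n).continuous
  have hfsm : ∀ k, ContDiff ℝ (⊤ : ℕ∞) (f k) := by
    intro k
    exact (phiP_contDiff N k.1).comp (contDiff_pi.mpr fun i => by fun_prop)
  have hfX : ∀ k, f k ∈ XX d := fun k =>
    ⟨hfsm k, HasCompactSupport.intro hcp fun x hx => hfZ k x fun hxZ => hx (hZK hxZ)⟩
  have hfa : ∀ k y, f k (aff l n y) = phiP N k.1 y := by
    intro k y
    simp only [f]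
    congr 1
    funext i
    simp only [aff]
    field_simp
    ring
  refine ⟨f, Z, hZc, hZg, hfX, hfZ, fun c hc => ?_⟩
  set u : Ed d → ℝ := ∑ k, c k • f k with hu
  have huX : u ∈ XX d := Submodule.sum_mem _ fun k _ => Submodule.smul_mem _ _ (hfX k)
  have huZ : ∀ x, x ∉ Z → u x = 0 := by
    intro x hx
    simp only [hu, Finset.sum_apply, Pi.smul_apply, smul_eq_mul]
    exact Finset.sum_eq_zero fun k _ => by rw [hfZ k x hx, mul_zero]
  have hua : ∀ y, u (aff l n y) = ∑ k, c k * phiP N k.1 y := by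
    intro y
    simp only [hu, Finset.sum_apply, Pi.smul_apply, smul_eq_mul, hfa]
  have e1 : ∫ x, u x ^ 2 = l ^ d * ∫ y in Icc (0 : Fin d → ℝ) 1, (∑ k, c k * phiP N k.1 y) ^ 2 := by
    rw [← setIntegral_eq_integral_of_forall_compl_eq_zero (s := gcube l n)
      (fun x hx => by rw [huZ x fun hz => hx (hZg hz)]; simp), int_gcube hl]
    simp_rw [hua]
  have hder : ∀ y i, l * fderiv ℝ u (aff l n y) (EuclideanSpace.single i 1) =
      ∑ k, c k * dphiP N i k.1 y := by
    intro y i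
    rw [← fderiv_comp_aff l n u y ((XX_one huX).differentiable (by norm_num) _) i]
    simp_rw [hua]
    rw [fderiv_fun_sum]
    · simp only [_root_.sum_apply]
      refine Finset.sum_congr rfl fun k _ => ?_
      rw [fderiv_const_mul]
      · simp [phiP_fderiv]
      · exact (phiP_contDiff (n := 1) N _).differentiable (by norm_num) _
    · intro k _
      exact ((phiP_contDiff (n := 1) N _).differentiable (by norm_num) _).const_mul _
  have e2 : ∫ x, ‖gradient u x‖ ^ 2 = l ^ d * (l ^ 2)⁻¹ *
      ∑ i, ∫ y in Icc (0 : Fin d → ℝ) 1, (∑ k, c k * dphiP N i k.1 y) ^ 2 := by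
    rw [← setIntegral_eq_integral_of_forall_compl_eq_zero (s := gcube l n)
      (fun x hx => by rw [grad_zero_of_supp hZc huZ fun hz => hx (hZg hz)]; simp), int_gcube hl]
    simp_rw [norm_gradient_sq]
    have : ∀ y, ∑ i, (fderiv ℝ u (aff l n y) (EuclideanSpace.single i 1)) ^ 2 =
        (l ^ 2)⁻¹ * ∑ i, (∑ k, c k * dphiP N i k.1 y) ^ 2 := by
      intro y
      rw [Finset.mul_sum]
      refine Finset.sum_congr rfl fun i _ => ?_
      rw [← hder]
      field_simp
    simp_rw [this]
    rw [integral_const_mul, integral_finsetSum, mul_assoc]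
    intro i _
    have := fun k : pfin d (l ^ 2 * mu) => dphiP_cont N i k.1
    exact cont_intOn_cube (by fun_prop)
  rw [e1, e2]
  have := h c hc
  calc _ < l ^ d * (l ^ 2)⁻¹ * (l ^ 2 * mu *
      ∫ y in Icc (0 : Fin d → ℝ) 1, (∑ k, c k * phiP N k.1 y) ^ 2) := by gcongr
    _ = _ := by field_simp

lemma schN_ge {d : ℕ} {l : ℝ} (hl : 0 < l) {V : Ed d → ℝ} (hV : Continuous V) (E : ℝ)
    (J : Finset (Fin d → ℤ)) (M : (Fin d → ℤ) → ℝ)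
    (hM : ∀ n ∈ J, ∀ x ∈ gcube l n, V x ≤ M n) :
    ((∑ n ∈ J, cnt1 d (l ^ 2 * (E - M n)) : ℕ) : ℕ∞) ≤ schN d V E := by
  classical
  choose f Z hZc hZg hfX hfZ hfc using fun n => dir_gcube hl n (E - M n)
  let I := Σ n : J, pfin d (l ^ 2 * (E - M n))
  let g : I → Ed d → ℝ := fun p => f p.1 p.2
  let Φ : (I → ℝ) →ₗ[ℝ] (Ed d → ℝ) := Fintype.linearCombination ℝ g
  let un : (I → ℝ) → J → Ed d → ℝ := fun c n => ∑ k, c ⟨n, k⟩ • f n k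
  have hΦ : ∀ c, Φ c = ∑ n, un c n := by
    intro c
    simp only [Φ, Fintype.linearCombination_apply, un, g]
    rw [Fintype.sum_sigma]
  have hunX : ∀ c n, un c n ∈ XX d := fun c n =>
    Submodule.sum_mem _ fun k _ => Submodule.smul_mem _ _ (hfX n k)
  have hunZ : ∀ c (n : J) x, x ∉ Z n → un c n x = 0 := by
    intro c n x hx
    simp only [un, Finset.sum_apply, Pi.smul_apply, smul_eq_mul]
    exact Finset.sum_eq_zero fun k _ => by rw [hfZ n k x hx, mul_zero]
  have hWc : Continuous fun x => V x - E := hV.sub continuous_const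
  have hfd : ∀ c x, fderiv ℝ (Φ c) x = ∑ n, fderiv ℝ (un c n) x := by
    intro c x
    rw [hΦ, fderiv_sum]
    intro n _
    exact (XX_one (hunX c n)).differentiable (by norm_num) _
  have hgr : ∀ c x, gradient (Φ c) x = ∑ n, gradient (un c n) x := by
    intro c x
    simp only [gradient, hfd, map_sum]
  have hdens : ∀ c x, dens (fun x => V x - E) (Φ c) x =
      ∑ n, dens (fun x => V x - E) (un c n) x := by
    intro c x
    unfold dens
    rw [hgr, hΦ, Finset.sum_apply]
    by_cases hx : ∃ n0 : J, x ∈ Z n0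
    · obtain ⟨n0, hx⟩ := hx
      have hz : ∀ n : J, n ≠ n0 → x ∉ Z n := by
        intro n hn hxn
        have := gcube_disjoint hl n.1 n0.1 fun h => hn (Subtype.ext h)
        exact Set.disjoint_left.mp this (hZg _ hxn) (hZg _ hx)
      rw [Finset.sum_eq_single n0, Finset.sum_eq_single n0, Finset.sum_eq_single n0]
      · intro n _ hn
        rw [hunZ c n x (hz n hn), grad_zero_of_supp (hZc n) (hunZ c n) (hz n hn)]
        simp
      · simp
      · intro n _ hn
        exact hunZ c n x (hz n hn)
      · simp
      · intro n _ hn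
        exact grad_zero_of_supp (hZc n) (hunZ c n) (hz n hn)
      · simp
    · push Not at hx
      have h1 : ∀ n : J, un c n x = 0 := fun n => hunZ c n x (hx n)
      have h2 : ∀ n : J, gradient (un c n) x = 0 :=
        fun n => grad_zero_of_supp (hZc n) (hunZ c n) (hx n)
      simp [h1, h2]
  have hsq : ∀ {u : Ed d → ℝ}, u ∈ XX d → Integrable fun x => u x ^ 2 := by
    intro u hu
    simpa using int_pot hu (W := fun _ => 1) continuous_const
  have hneg : ∀ c, c ≠ 0 → ∫ x, dens (fun x => V x - E) (Φ c) x < 0 := by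
    intro c hc
    simp_rw [hdens]
    rw [integral_finsetSum _ fun n _ => int_dens (hunX c n) hWc]
    have hle : ∀ n : J, (fun k => c ⟨n, k⟩) ≠ 0 →
        ∫ x, dens (fun x => V x - E) (un c n) x < 0 := by
      intro n hcn
      have h1 := hfc n (fun k => c ⟨n, k⟩) hcn
      have h2 : ∫ x, dens (fun x => V x - E) (un c n) x ≤
          ∫ x, (‖gradient (un c n) x‖ ^ 2 - (E - M n) * un c n x ^ 2) := by
        refine integral_mono (int_dens (hunX c n) hWc)
          ((int_grad (hunX c n)).sub ((hsq (hunX c n)).const_mul _)) fun x => ?_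
        simp only [dens]
        by_cases hx : x ∈ Z n
        · have := hM n n.2 x (hZg _ hx)
          nlinarith [sq_nonneg (un c n x)]
        · rw [hunZ c n x hx]; simp
      rw [integral_sub (int_grad (hunX c n)) ((hsq (hunX c n)).const_mul _),
        integral_const_mul] at h2
      simp only [un] at h2 ⊢
      linarith
    have hle' : ∀ n : J, ∫ x, dens (fun x => V x - E) (un c n) x ≤ 0 := by
      intro n
      by_cases hcn : (fun k => c ⟨n, k⟩) = 0
      · have : un c n = 0 := by
          simp only [un]
          refine Finset.sum_eq_zero fun k _ => ?_
          have := congrFun hcn k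
          simp only [Pi.zero_apply] at this
          rw [this, zero_smul]
        rw [this]
        have h0 : ∀ x, dens (fun x => V x - E) (0 : Ed d → ℝ) x = 0 := by
          intro x
          simp [dens, gradient, fderiv_zero]
        simp [h0]
      · exact (hle n hcn).le
    obtain ⟨⟨n, k⟩, hp⟩ := Function.ne_iff.mp hc
    refine Finset.sum_neg' (fun n _ => hle' n) ⟨n, Finset.mem_univ _, hle n ?_⟩
    intro h0
    exact hp (congrFun h0 k)
  have hΦX : ∀ c, Φ c ∈ XX d := fun c => by
    rw [hΦ]; exact Submodule.sum_mem _ fun n _ => hunX c n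
  have hinj : Function.Injective Φ := by
    rw [← LinearMap.ker_eq_bot, LinearMap.ker_eq_bot']
    intro c hc
    by_contra hne
    have := hneg c hne
    rw [hc] at this
    have h0 : ∀ x, dens (fun x => V x - E) (0 : Ed d → ℝ) x = 0 := by
      intro x
      simp [dens, gradient, fderiv_zero]
    simp [h0] at this
  have hcard : Module.finrank ℝ (LinearMap.range Φ) = ∑ n ∈ J, cnt1 d (l ^ 2 * (E - M n)) := by
    rw [LinearMap.finrank_range_of_inj hinj, Module.finrank_fintype_fun_eq_card,
      Fintype.card_sigma]
    simp only [Fintype.card_coe]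
    exact Finset.sum_coe_sort J (fun n => (pfin d (l ^ 2 * (E - M n))).card)
  rw [← hcard]
  unfold schN
  refine le_iSup_of_le ⟨LinearMap.range Φ, ?_, ?_⟩ le_rfl
  · rintro _ ⟨c, rfl⟩
    exact hΦX c
  · rintro _ ⟨c, rfl⟩ hne
    have hc : c ≠ 0 := by rintro rfl; exact hne (map_zero _)
    have h1 := hneg c hc
    have h2 : ∀ x, dens (fun x => V x - E) (Φ c) x =
        (‖gradient (Φ c) x‖ ^ 2 + V x * Φ c x ^ 2) - E * Φ c x ^ 2 := fun x => by
      simp only [dens]; ring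
    simp_rw [h2] at h1
    rw [integral_sub (f := fun x => ‖gradient (Φ c) x‖ ^ 2 + V x * Φ c x ^ 2)
      ((int_grad (hΦX c)).add (int_pot (hΦX c) hV)) ((hsq (hΦX c)).const_mul _),
      integral_const_mul] at h1
    linarith


/-! ### Lattice point counting -/

def orth (d : ℕ) (q : Prop) : Set (Fin d → ℝ) :=
  {x | (∀ i, 0 ≤ x i ∧ (q → 0 < x i)) ∧ ∑ i, x i ^ 2 < 1}

lemma orth_measurable (d : ℕ) (q : Prop) : MeasurableSet (orth d q) := by
  have : orth d q = (⋂ i, ({x : Fin d → ℝ | 0 ≤ x i} ∩ {x | q → 0 < x i})) ∩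
      {x | ∑ i, x i ^ 2 < 1} := by
    ext x; simp [orth]
  rw [this]
  refine (MeasurableSet.iInter fun i => ?_).inter ?_
  · have hm : Measurable fun x : Fin d → ℝ => x i := by fun_prop
    refine (measurableSet_le measurable_const hm).inter ?_
    by_cases hq : q
    · simp only [hq, true_imp_iff]; exact measurableSet_lt measurable_const hm
    · simp [hq]
  · exact measurableSet_lt (by fun_prop) measurable_const

lemma orth_bounded (d : ℕ) (q : Prop) : Bornology.IsBounded (orth d q) := by
  refine (Metric.isBounded_Icc (0 : Fin d → ℝ) 1).subset ?_
  intro x hx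
  refine ⟨fun i => (hx.1 i).1, fun i => ?_⟩
  have h1 : (x i) ^ 2 ≤ ∑ i, x i ^ 2 :=
    Finset.single_le_sum (f := fun i => x i ^ 2) (fun i _ => sq_nonneg _) (Finset.mem_univ i)
  have h2 := hx.2
  simp only [Pi.one_apply]
  nlinarith [(hx.1 i).1]

lemma orth_convex (d : ℕ) (q : Prop) : Convex ℝ (orth d q) := by
  intro x hx y hy a b ha hb hab
  refine ⟨fun i => ⟨?_, fun hq => ?_⟩, ?_⟩
  · have := (hx.1 i).1; have := (hy.1 i).1
    simp only [Pi.add_apply, Pi.smul_apply, smul_eq_mul]; positivity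
  · have h1 := (hx.1 i).2 hq; have h2 := (hy.1 i).2 hq
    simp only [Pi.add_apply, Pi.smul_apply, smul_eq_mul]
    rcases ha.eq_or_lt with h | h
    · have : b = 1 := by linarith
      rw [← h, this]; linarith
    · have := mul_pos h h1
      have := mul_nonneg hb h2.le
      linarith
  · have h1 : ∀ i, ((a • x + b • y) i) ^ 2 ≤ a * x i ^ 2 + b * y i ^ 2 := by
      intro i
      simp only [Pi.add_apply, Pi.smul_apply, smul_eq_mul]
      have : b = 1 - a := by linarith
      subst this
      nlinarith [mul_nonneg (mul_nonneg ha hb) (sq_nonneg (x i - y i))]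
    have h2 : ∑ i, ((a • x + b • y) i) ^ 2 ≤ a * ∑ i, x i ^ 2 + b * ∑ i, y i ^ 2 := by
      rw [Finset.mul_sum, Finset.mul_sum, ← Finset.sum_add_distrib]
      exact Finset.sum_le_sum fun i _ => h1 i
    have hx2 := hx.2
    have hy2 := hy.2
    rcases ha.eq_or_lt with h | h
    · have : b = 1 := by linarith
      rw [← h, this] at h2 ⊢; linarith
    · nlinarith

open scoped Pointwise in
lemma orth_star (d : ℕ) (q : Prop) ⦃x y : ℝ⦄ (hx : 0 < x) (hxy : x ≤ y) :
    x • orth d q ⊆ y • orth d q := by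
  rintro _ ⟨z, hz, rfl⟩
  have hy : 0 < y := hx.trans_le hxy
  refine ⟨(x / y) • z, ⟨fun i => ⟨?_, fun hq => ?_⟩, ?_⟩, ?_⟩
  · have := (hz.1 i).1
    simp only [Pi.smul_apply, smul_eq_mul]; positivity
  · have := (hz.1 i).2 hq
    simp only [Pi.smul_apply, smul_eq_mul]; positivity
  · simp only [Pi.smul_apply, smul_eq_mul, mul_pow, ← Finset.mul_sum]
    have h1 : x / y ≤ 1 := by rw [div_le_one hy]; exact hxy
    have h2 : 0 ≤ x / y := by positivity
    have h3 : (x / y) ^ 2 ≤ 1 := by nlinarith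
    have h4 : 0 ≤ ∑ i, z i ^ 2 := Finset.sum_nonneg fun i _ => sq_nonneg _
    have h5 := hz.2
    nlinarith
  · simp only [smul_smul]
    congr 1
    field_simp

lemma orth_vol (d : ℕ) (q : Prop) : volume.real (orth d q) = tau d / 2 ^ d := by
  have hnull : ∀ᵐ x : Fin d → ℝ, ∀ i, x i ≠ 0 := by
    rw [ae_all_iff]
    intro i
    exact Measure.ae_eval_ne (fun _ => (volume : Measure ℝ)) i 0
  have hq : volume (orth d q) = volume (orth d True) := by
    refine measure_congr ?_
    filter_upwards [hnull] with x hx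
    apply propext
    constructor
    · intro h
      exact ⟨fun i => ⟨(h.1 i).1, fun _ => lt_of_le_of_ne (h.1 i).1 (hx i).symm⟩, h.2⟩
    · intro h
      exact ⟨fun i => ⟨(h.1 i).1, fun _ => (h.1 i).2 trivial⟩, h.2⟩
  let fl : (Fin d → Bool) → (Fin d → ℝ) → (Fin d → ℝ) := fun σ x i => if σ i then x i else - x i
  have hfl : ∀ σ, MeasurePreserving (fl σ) := by
    intro σ
    have := volume_preserving_pi (ι := Fin d) (α' := fun _ => ℝ) (β' := fun _ => ℝ)
      (f := fun i x => if σ i then x else - x) (by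
        intro i
        cases σ i
        · simpa using Measure.measurePreserving_neg (volume : Measure ℝ)
        · simp only [if_true]
          exact MeasurePreserving.id (volume : Measure ℝ))
    exact this
  have hball : volume (Metric.ball (0 : Ed d) 1) = volume {x : Fin d → ℝ | ∑ i, x i ^ 2 < 1} := by
    rw [← (PiLp.volume_preserving_toLp (Fin d)).measure_preimage
      measurableSet_ball.nullMeasurableSet]
    congr 1
    ext x
    simp only [mem_preimage, Metric.mem_ball, dist_zero_right, EuclideanSpace.norm_eq,
      Real.norm_eq_abs, sq_abs, mem_ofPred_eq]
    rw [Real.sqrt_lt' one_pos, one_pow]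
  have hun : volume {x : Fin d → ℝ | ∑ i, x i ^ 2 < 1} =
      volume (⋃ σ, fl σ ⁻¹' (orth d True)) := by
    refine measure_congr ?_
    filter_upwards [hnull] with x hx
    apply propext
    have hsq : ∀ σ, ∑ i, (fl σ x i) ^ 2 = ∑ i, x i ^ 2 := by
      intro σ
      refine Finset.sum_congr rfl fun i _ => ?_
      simp only [fl]
      split_ifs <;> ring
    constructor
    · intro h
      have h' : ∑ i, x i ^ 2 < 1 := h
      refine mem_iUnion.mpr ⟨fun i => decide (0 < x i), ?_, ?_⟩
      · intro i
        have : 0 < fl (fun i => decide (0 < x i)) x i := by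
          simp only [fl, decide_eq_true_eq]
          split_ifs with h0
          · exact h0
          · have := hx i
            push Not at h0
            have := lt_of_le_of_ne h0 this
            linarith
        exact ⟨this.le, fun _ => this⟩
      · rw [hsq]; exact h'
    · intro h
      obtain ⟨σ, hσ⟩ := mem_iUnion.mp h
      have := hσ.2
      rw [hsq] at this
      exact this
  have hdisj : Pairwise (Function.onFun Disjoint fun σ => fl σ ⁻¹' (orth d True)) := by
    intro σ τ hne
    refine Set.disjoint_left.mpr fun x h1 h2 => hne ?_
    funext i
    have a1 := (h1.1 i).2 trivial
    have a2 := (h2.1 i).2 trivial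
    simp only [fl] at a1 a2
    cases hs : σ i <;> cases ht : τ i <;> simp_all <;> linarith
  have hsum : volume (⋃ σ, fl σ ⁻¹' (orth d True)) = 2 ^ d * volume (orth d True) := by
    rw [measure_iUnion hdisj fun σ => (hfl σ).measurable (orth_measurable d True), tsum_fintype]
    simp_rw [fun σ => (hfl σ).measure_preimage (orth_measurable d True).nullMeasurableSet]
    simp
  have : tau d = 2 ^ d * volume.real (orth d True) := by
    rw [tau, hball, hun, hsum, ENNReal.toReal_mul]
    simp [Measure.real]
  rw [this, measureReal_def, hq, ← measureReal_def]
  field_simp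

open scoped Pointwise in
lemma orth_card (d : ℕ) (q : Prop) {r : ℝ} (hr : 0 < r) :
    Nat.card ↑(orth d q ∩ r⁻¹ • (Submodule.span ℤ (Set.range (Pi.basisFun ℝ (Fin d))) :
      Set (Fin d → ℝ))) =
    {k : Fin d → ℕ | ∑ i, (π * k i) ^ 2 < (π * r) ^ 2 ∧ (q → ∀ i, 0 < k i)}.ncard := by
  let g : (Fin d → ℕ) → (Fin d → ℝ) := fun k i => r⁻¹ * k i
  have hg : Function.Injective g := by
    intro k k' h
    funext i
    have := congrFun h i
    simp only [g] at this
    exact_mod_cast mul_left_cancel₀ (by positivity) this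
  rw [Nat.card_coe_set_eq, ← Set.ncard_image_of_injective _ hg]
  congr 1
  have hiff : ∀ k : Fin d → ℕ, ∑ i, (π * k i) ^ 2 < (π * r) ^ 2 ↔ ∑ i, (r⁻¹ * k i) ^ 2 < 1 := by
    intro k
    simp_rw [mul_pow, ← Finset.mul_sum]
    rw [mul_lt_mul_iff_right₀ (by positivity), inv_pow, inv_mul_lt_iff₀ (by positivity), mul_one]
  ext x
  constructor
  · rintro ⟨hx, z, hz, rfl⟩
    rw [SetLike.mem_coe, (Pi.basisFun ℝ (Fin d)).mem_span_iff_repr_mem ℤ] at hz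
    choose w hw using hz
    have hw' : ∀ i, z i = w i := fun i => by simpa using (hw i).symm
    have hw0 : ∀ i, 0 ≤ w i := by
      intro i
      have h1 := (hx.1 i).1
      simp only [Pi.smul_apply, smul_eq_mul] at h1
      have h2 : 0 ≤ z i := nonneg_of_mul_nonneg_right h1 (by positivity)
      rw [hw' i] at h2
      exact_mod_cast h2
    have hzk : ∀ i, z i = ((w i).toNat : ℝ) := by
      intro i
      rw [hw' i]
      have := Int.toNat_of_nonneg (hw0 i)
      exact_mod_cast this.symm
    refine ⟨fun i => (w i).toNat, ⟨?_, ?_⟩, ?_⟩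
    · rw [hiff]
      have := hx.2
      simp only [Pi.smul_apply, smul_eq_mul, hzk] at this
      exact this
    · intro hq i
      have h1 := (hx.1 i).2 hq
      simp only [Pi.smul_apply, smul_eq_mul, hzk] at h1
      have h2 := (mul_pos_iff_of_pos_left (by positivity : 0 < r⁻¹)).mp h1
      exact_mod_cast h2
    · funext i
      simp [g, hzk]
  · rintro ⟨k, ⟨hk, hkq⟩, rfl⟩
    refine ⟨⟨fun i => ⟨by simp only [g]; positivity, fun hq => ?_⟩, ?_⟩, ?_⟩
    · have := hkq hq i
      simp only [g]; positivity
    · exact (hiff k).mp hk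
    · refine ⟨fun i => (k i : ℝ), ?_, ?_⟩
      · rw [SetLike.mem_coe, (Pi.basisFun ℝ (Fin d)).mem_span_iff_repr_mem ℤ]
        intro i
        exact ⟨k i, by simp⟩
      · funext i; simp [g]

open scoped Pointwise in
lemma orth_asymp (d : ℕ) (q : Prop) {η : ℝ} (hη : 0 < η) : ∃ r0 : ℝ, 0 < r0 ∧ ∀ r ≥ r0,
    |({k : Fin d → ℕ | ∑ i, (π * k i) ^ 2 < (π * r) ^ 2 ∧ (q → ∀ i, 0 < k i)}.ncard : ℝ)
      - tau d / 2 ^ d * r ^ d| ≤ η * r ^ d := by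
  have h := tendsto_card_div_pow_atTop_volume' (orth d q) (orth_bounded d q) (orth_measurable d q)
    ((orth_convex d q).addHaar_frontier volume) (orth_star d q)
  rw [orth_vol] at h
  have h2 := h.eventually (Metric.closedBall_mem_nhds _ hη)
  obtain ⟨r1, hr1⟩ := eventually_atTop.mp h2
  refine ⟨max r1 1, by positivity, fun r hr => ?_⟩
  have hr0 : 0 < r := by linarith [le_max_right r1 1]
  have h3 := hr1 r (by linarith [le_max_left r1 1])
  rw [orth_card d q hr0, Real.dist_eq, Fintype.card_fin] at h3
  have hp : 0 < r ^ d := by positivity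
  calc _ = |({k : Fin d → ℕ | ∑ i, (π * k i) ^ 2 < (π * r) ^ 2 ∧ (q → ∀ i, 0 < k i)}.ncard : ℝ)
      / r ^ d - tau d / 2 ^ d| * r ^ d := by
        rw [← abs_of_pos hp, ← abs_mul, abs_of_pos hp, sub_mul, div_mul_cancel₀ _ hp.ne']
    _ ≤ _ := by gcongr

lemma cnt0_bound (d : ℕ) {η : ℝ} (hη : 0 < η) : ∃ A : ℝ, 0 ≤ A ∧ ∀ lam : ℝ,
    (cnt0 d lam : ℝ) ≤ (tau d / 2 ^ d + η) * (√lam / π) ^ d + A := by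
  obtain ⟨r0, hr0, h⟩ := orth_asymp d False hη
  have ht : 0 ≤ tau d := ENNReal.toReal_nonneg
  refine ⟨(1 + π * r0) ^ d, by positivity, fun lam => ?_⟩
  set r := √lam / π with hr
  have hrn : 0 ≤ r := by positivity
  have hrl : π * r = √lam := by rw [hr]; field_simp
  rcases lt_or_ge r r0 with h1 | h1
  · refine (cnt0_crude d lam).trans ?_
    have : (1 + √lam) ^ d ≤ (1 + π * r0) ^ d := by
      rw [← hrl]; gcongr
    have h3 : 0 ≤ (tau d / 2 ^ d + η) * r ^ d := by positivity
    linarith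
  · have h2 := (abs_le.mp (h r h1)).2
    have hl : 0 < lam := by
      have : 0 < √lam := by rw [← hrl]; nlinarith [pi_pos]
      exact Real.sqrt_pos.mp this
    simp only [false_imp_iff, and_true, hrl, Real.sq_sqrt hl.le] at h2
    have h3 : (0:ℝ) ≤ (1 + π * r0) ^ d := by positivity
    have h4 : (cnt0 d lam : ℝ) = ({k : Fin d → ℕ | ∑ i, (π * k i) ^ 2 < lam}.ncard : ℝ) := rfl
    rw [h4]
    linarith

lemma cnt1_bound (d : ℕ) {η : ℝ} (hη : 0 < η) : ∃ A : ℝ, 0 ≤ A ∧ ∀ lam : ℝ,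
    (tau d / 2 ^ d - η) * (√lam / π) ^ d - A ≤ (cnt1 d lam : ℝ) := by
  obtain ⟨r0, hr0, h⟩ := orth_asymp d True hη
  have ht : 0 ≤ tau d := ENNReal.toReal_nonneg
  refine ⟨tau d / 2 ^ d * r0 ^ d, by positivity, fun lam => ?_⟩
  set r := √lam / π with hr
  have hrn : 0 ≤ r := by positivity
  have hrl : π * r = √lam := by rw [hr]; field_simp
  rcases lt_or_ge r r0 with h1 | h1
  · have : tau d / 2 ^ d * r ^ d ≤ tau d / 2 ^ d * r0 ^ d := by gcongr
    have h3 : 0 ≤ η * r ^ d := by positivity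
    have h4 : (0:ℝ) ≤ cnt1 d lam := by positivity
    linarith
  · have h2 := (abs_le.mp (h r h1)).1
    have hl : 0 < lam := by
      have : 0 < √lam := by rw [← hrl]; nlinarith [pi_pos]
      exact Real.sqrt_pos.mp this
    simp only [true_imp_iff, hrl, Real.sq_sqrt hl.le] at h2
    have h4 : cnt1 d lam = {k : Fin d → ℕ | ∑ i, (π * k i) ^ 2 < lam ∧ ∀ i, 0 < k i}.ncard := by
      rw [cnt1, ← Set.ncard_coe_finset]
      congr 1
      ext k
      simp [mem_pfin]
    rw [h4]
    have h3 : 0 ≤ tau d / 2 ^ d * r0 ^ d := by positivity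
    linarith


/-! ### Semiclassical density -/

def Gf (d : ℕ) (t : ℝ) : ℝ := (max t 0) ^ ((d : ℝ) / 2)

lemma Gf_nonneg (d : ℕ) (t : ℝ) : 0 ≤ Gf d t := by unfold Gf; positivity

lemma Gf_cont (d : ℕ) : Continuous (Gf d) :=
  (continuous_id.max continuous_const).rpow_const fun _ => Or.inr (by positivity)

lemma Gf_mono (d : ℕ) {s t : ℝ} (h : s ≤ t) : Gf d s ≤ Gf d t := by
  unfold Gf
  gcongr

lemma Gf_zero {d : ℕ} (hd : 1 ≤ d) {t : ℝ} (ht : t ≤ 0) : Gf d t = 0 := by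
  unfold Gf
  rw [max_eq_right ht, Real.zero_rpow]
  positivity

lemma Gf_mul (d : ℕ) {a : ℝ} (ha : 0 ≤ a) (t : ℝ) : Gf d (a * t) = a ^ ((d:ℝ) / 2) * Gf d t := by
  unfold Gf
  rw [← Real.mul_rpow ha (le_max_right _ _), mul_max_of_nonneg _ _ ha, mul_zero]

lemma Gf_sqrt (d : ℕ) (t : ℝ) : (√t) ^ d = Gf d t := by
  have : √t = √(max t 0) := by
    rcases le_total t 0 with h | h
    · rw [max_eq_right h, Real.sqrt_eq_zero_of_nonpos h, Real.sqrt_zero]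
    · rw [max_eq_left h]
  rw [this, Gf, Real.sqrt_eq_rpow, ← Real.rpow_natCast, ← Real.rpow_mul (le_max_right _ _)]
  congr 1; ring

def kap (d : ℕ) : ℝ := tau d / (2 * π) ^ d

lemma kap_nonneg (d : ℕ) : 0 ≤ kap d := div_nonneg ENNReal.toReal_nonneg (by positivity)

lemma cnt_arg (d : ℕ) {l : ℝ} (hl : 0 < l) (c : ℝ) :
    (√(l ^ 2 * c) / π) ^ d = (l ^ d * Gf d c) / π ^ d := by
  rw [Real.sqrt_mul (sq_nonneg l), Real.sqrt_sq hl.le, div_pow, mul_pow, Gf_sqrt]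

lemma cnt0_bd (d : ℕ) {η : ℝ} (hη : 0 < η) : ∃ A : ℝ, 0 ≤ A ∧ ∀ l : ℝ, 0 < l → ∀ c : ℝ,
    (cnt0 d (l ^ 2 * c) : ℝ) ≤ (kap d + η) * (l ^ d * Gf d c) + A := by
  obtain ⟨A, hA, h⟩ := cnt0_bound d (η := η * π ^ d) (by positivity)
  refine ⟨A, hA, fun l hl c => (h _).trans (le_of_eq ?_)⟩
  rw [cnt_arg d hl, kap, mul_pow]
  field_simp

lemma cnt1_bd (d : ℕ) {η : ℝ} (hη : 0 < η) : ∃ A : ℝ, 0 ≤ A ∧ ∀ l : ℝ, 0 < l → ∀ c : ℝ,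
    (kap d - η) * (l ^ d * Gf d c) - A ≤ (cnt1 d (l ^ 2 * c) : ℝ) := by
  obtain ⟨A, hA, h⟩ := cnt1_bound d (η := η * π ^ d) (by positivity)
  refine ⟨A, hA, fun l hl c => (le_of_eq ?_).trans (h _)⟩
  rw [cnt_arg d hl, kap, mul_pow]
  field_simp

lemma Gf_unif (d : ℕ) (B : ℝ) {η : ℝ} (hη : 0 < η) : ∃ δ : ℝ, 0 < δ ∧ ∀ s t : ℝ,
    |s| ≤ B → |s - t| ≤ δ → |Gf d s - Gf d t| ≤ η := by
  have huc : UniformContinuousOn (Gf d) (Icc (-(B + 1)) (B + 1)) :=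
    isCompact_Icc.uniformContinuousOn_of_continuous (Gf_cont d).continuousOn
  rw [Metric.uniformContinuousOn_iff] at huc
  obtain ⟨δ, hδ, h⟩ := huc η hη
  refine ⟨min (δ / 2) 1, by positivity, fun s t hs hst => ?_⟩
  have h1 := hst.trans (min_le_left _ _)
  have h2 := hst.trans (min_le_right _ _)
  rw [abs_le] at hs h2
  have := h s ⟨by linarith, by linarith⟩ t ⟨by linarith, by linarith⟩
    (by rw [Real.dist_eq]; linarith)
  rw [Real.dist_eq] at this
  exact this.le

/-! ### Geometry of small cubes -/

lemma gcube_convex {d : ℕ} (l : ℝ) (n : Fin d → ℤ) : Convex ℝ (gcube (d := d) l n) := by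
  intro x hx y hy a b ha hb hab i
  have h1 := hx i
  have h2 := hy i
  simp only [PiLp.add_apply, PiLp.smul_apply, smul_eq_mul]
  have e : b = 1 - a := by linarith
  subst e
  constructor
  · nlinarith
  · rcases ha.eq_or_lt with h | h
    · rw [← h]; linarith [h2.2]
    · nlinarith

lemma gcube_norm_sub {d : ℕ} {l : ℝ} (hl : 0 < l) {n : Fin d → ℤ} {x y : Ed d}
    (hx : x ∈ gcube l n) (hy : y ∈ gcube l n) : ‖x - y‖ ≤ √d * l := by
  rw [EuclideanSpace.norm_eq]
  calc √(∑ i, ‖(x - y) i‖ ^ 2) ≤ √(∑ _i : Fin d, l ^ 2) := by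
        apply Real.sqrt_le_sqrt
        refine Finset.sum_le_sum fun i _ => ?_
        have h1 := hx i
        have h2 := hy i
        rw [Real.norm_eq_abs]
        apply pow_le_pow_left₀ (abs_nonneg _)
        rw [PiLp.sub_apply, abs_le]
        constructor <;> linarith
    _ = √d * l := by
        simp [Real.sqrt_sq hl.le]

lemma gcube_zero_mem {d : ℕ} {l : ℝ} (hl : 0 < l) (n : Fin d → ℤ) : aff l n 0 ∈ gcube l n := by
  intro i
  simp only [aff, Pi.zero_apply, add_zero]
  constructor <;> nlinarith

lemma osc_V {d : ℕ} {ρ : ℝ} (hρ : ρ ∈ Ioo (0:ℝ) 2) {V : Ed d → ℝ} (hV : ContDiff ℝ 1 V)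
    {C : ℝ} (hC : 0 < C) (hgrad : ∀ x : Ed d, ‖gradient V x‖ ≤ C * (1 + ‖x‖) ^ (-ρ - 1))
    {l : ℝ} (hl : 0 < l) {m K : ℕ} (hm : 0 < m) {n : Fin d → ℤ} (hn : n ∈ annIdx d m K) {x y : Ed d}
    (hx : x ∈ gcube l n) (hy : y ∈ gcube l n) :
    |V x - V y| ≤ C * √d * (m * l) ^ (-ρ) / m := by
  have hml : 0 < m * l := by positivity
  have key : ∀ z ∈ gcube l n, ‖fderiv ℝ V z‖ ≤ C * (m * l) ^ (-ρ - 1) := by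
    intro z hz
    have h1 : ‖fderiv ℝ V z‖ = ‖gradient V z‖ := by
      rw [gradient]; simp
    rw [h1]
    refine (hgrad z).trans ?_
    have h2 := norm_ge_of_ann hl hn hz
    gcongr ?_ * ?_
    apply Real.rpow_le_rpow_of_nonpos hml (by linarith)
    linarith [hρ.1]
  have := (gcube_convex l n).norm_image_sub_le_of_norm_fderiv_le (𝕜 := ℝ) (f := V)
    (fun z _ => (hV.differentiable (by norm_num)).differentiableAt) key hy hx
  rw [Real.norm_eq_abs] at this
  refine this.trans ?_
  calc C * (m * l) ^ (-ρ - 1) * ‖x - y‖ ≤ C * (m * l) ^ (-ρ - 1) * (√d * l) := by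
        gcongr
        exact gcube_norm_sub hl hx hy
    _ = _ := by
        rw [Real.rpow_sub_one hml.ne']
        field_simp

lemma V_ann {d : ℕ} {ρ : ℝ} (hρ : ρ ∈ Ioo (0:ℝ) 2) {V : Ed d → ℝ} {C : ℝ} (hC : 0 < C)
    (hbd : ∀ x : Ed d, |V x| ≤ C * (1 + ‖x‖) ^ (-ρ)) {r : ℝ} (hr : 0 < r) {x : Ed d}
    (hx : r ≤ ‖x‖) : |V x| ≤ C * r ^ (-ρ) := by
  refine (hbd x).trans ?_
  gcongr ?_ * ?_
  apply Real.rpow_le_rpow_of_nonpos hr (by linarith)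
  linarith [hρ.1]

lemma V_out {d : ℕ} {ρ : ℝ} (hρ : ρ ∈ Ioo (0:ℝ) 2) {V : Ed d → ℝ} {C : ℝ} (hC : 0 < C)
    (hbd : ∀ x : Ed d, |V x| ≤ C * (1 + ‖x‖) ^ (-ρ)) {L : ℝ} (hL : 0 < L) {x : Ed d}
    (hx : C ^ (1 / ρ) * L ≤ ‖x‖) : -L ^ (-ρ) ≤ V x := by
  have h := V_ann hρ hC hbd (by positivity) hx
  rw [Real.mul_rpow (by positivity) hL.le, ← Real.rpow_mul hC.le] at h
  have e : 1 / ρ * -ρ = -1 := by have := hρ.1.ne'; field_simp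
  rw [e, Real.rpow_neg_one, mul_inv_cancel_left₀ hC.ne'] at h
  exact (abs_le.1 h).1

lemma int_gcube_const {d : ℕ} {l : ℝ} (hl : 0 < l) (n : Fin d → ℤ) (c : ℝ) :
    ∫ _x in gcube (d := d) l n, c = l ^ d * c := by
  rw [int_gcube hl n (fun _ => c)]
  simp [Measure.real, Real.volume_Icc_pi]


lemma bbox_norm {d : ℕ} {r : ℝ} (hr : 0 ≤ r) {x : Ed d} (hx : x ∈ bbox r) : ‖x‖ ≤ √d * r := by
  rw [EuclideanSpace.norm_eq]
  calc √(∑ i, ‖x i‖ ^ 2) ≤ √(∑ _i : Fin d, r ^ 2) := by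
        apply Real.sqrt_le_sqrt
        refine Finset.sum_le_sum fun i _ => ?_
        have h1 := hx i
        rw [Real.norm_eq_abs]
        apply pow_le_pow_left₀ (abs_nonneg _)
        rw [abs_le]
        constructor <;> linarith
    _ = √d * r := by
        simp [Real.sqrt_sq hr]

lemma Lam_eq (d : ℕ) (ρ : ℝ) {L : ℝ} (hL : 0 < L) :
    L ^ d * (L ^ (-ρ)) ^ ((d:ℝ) / 2) = (L ^ (1 - ρ / 2)) ^ d := by
  rw [← Real.rpow_mul hL.le, ← Real.rpow_natCast, ← Real.rpow_natCast, ← Real.rpow_mul hL.le,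
    ← Real.rpow_add hL]
  congr 1; ring

lemma Gf_int_on {d : ℕ} {V : Ed d → ℝ} (hV : Continuous V) (E : ℝ) {r : ℝ} {S : Set (Ed d)}
    (hS : S ⊆ bbox r) (hr : 0 ≤ r) : IntegrableOn (fun x => Gf d (E - V x)) S := by
  have hc : Continuous (fun x => Gf d (E - V x)) := (Gf_cont d).comp (by fun_prop)
  have h := hc.continuousOn.integrableOn_compact (μ := volume)
    (isCompact_closedBall (0 : Ed d) (√d * r))
  refine h.mono_set fun x hx => ?_
  rw [mem_closedBall_zero_iff]
  exact bbox_norm hr (hS hx)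

lemma Gf_support {d : ℕ} (hd : 1 ≤ d) {ρ : ℝ} (hρ : ρ ∈ Ioo (0:ℝ) 2) {V : Ed d → ℝ}
    {C : ℝ} (hC : 0 < C) (hbd : ∀ x : Ed d, |V x| ≤ C * (1 + ‖x‖) ^ (-ρ)) {L : ℝ} (hL : 0 < L)
    {r : ℝ} (hr : C ^ (1 / ρ) * L ≤ r) {x : Ed d} (hx : x ∉ bbox r) :
    Gf d (-L ^ (-ρ) - V x) = 0 := by
  apply Gf_zero hd
  have := V_out hρ hC hbd hL (hr.trans (norm_ge_of_not_bbox x hx))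
  linarith

lemma Gf_integral_eq {d : ℕ} (hd : 1 ≤ d) {ρ : ℝ} (hρ : ρ ∈ Ioo (0:ℝ) 2) {V : Ed d → ℝ}
    {C : ℝ} (hC : 0 < C) (hbd : ∀ x : Ed d, |V x| ≤ C * (1 + ‖x‖) ^ (-ρ)) {L : ℝ} (hL : 0 < L)
    {r : ℝ} (hr : C ^ (1 / ρ) * L ≤ r) :
    ∫ x, Gf d (-L ^ (-ρ) - V x) = ∫ x in bbox r, Gf d (-L ^ (-ρ) - V x) :=
  (setIntegral_eq_integral_of_forall_compl_eq_zero fun _ hx =>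
    Gf_support hd hρ hC hbd hL hr hx).symm

lemma Gf_integrable {d : ℕ} (hd : 1 ≤ d) {ρ : ℝ} (hρ : ρ ∈ Ioo (0:ℝ) 2) {V : Ed d → ℝ}
    (hV : Continuous V) {C : ℝ} (hC : 0 < C) (hbd : ∀ x : Ed d, |V x| ≤ C * (1 + ‖x‖) ^ (-ρ))
    {L : ℝ} (hL : 0 < L) : Integrable (fun x => Gf d (-L ^ (-ρ) - V x)) := by
  have h := Gf_int_on hV (-L ^ (-ρ)) (subset_refl (bbox (C ^ (1 / ρ) * L))) (by positivity)
  refine (integrableOn_iff_integrable_of_support_subset ?_).1 h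
  intro x hx
  by_contra hx'
  exact hx (Gf_support hd hρ hC hbd hL le_rfl hx')

open scoped Pointwise in
lemma smul_bbox {d : ℕ} {r : ℝ} (hr : 0 < r) : r • bbox (d := d) 1 = bbox r := by
  ext x
  rw [mem_smul_set_iff_inv_smul_mem₀ hr.ne']
  refine forall_congr' fun i => ?_
  simp only [PiLp.smul_apply, smul_eq_mul]
  rw [inv_mul_lt_iff₀ hr, le_inv_mul_iff₀ hr]
  simp

open scoped Pointwise in
lemma core_int {d : ℕ} (hd : 1 ≤ d) {ρ : ℝ} (hρ : ρ ∈ Ioo (0:ℝ) 2) {V : Ed d → ℝ}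
    (hV : Continuous V) {C : ℝ} (hC : 0 < C) (hbd : ∀ x : Ed d, |V x| ≤ C * (1 + ‖x‖) ^ (-ρ)) :
    ∃ K1 : ℝ, 0 ≤ K1 ∧ ∀ E ≤ 0, ∀ r : ℝ, 0 < r →
      ∫ x in bbox r, Gf d (E - V x) ≤ K1 * (r ^ (1 - ρ / 2)) ^ d := by
  have : Nonempty (Fin d) := ⟨⟨0, hd⟩⟩
  have : Nontrivial (Ed d) := inferInstance
  set a : ℝ := ρ * (d / 2) with ha
  set I : ℝ := ∫ x in bbox (d := d) 1, ‖x‖ ^ (-a) with hI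
  have hd' : (1:ℝ) ≤ d := by exact_mod_cast hd
  have had : a < d := by rw [ha]; nlinarith [hρ.2]
  have h_intg : ∀ r : ℝ, 0 < r → IntegrableOn (fun x : Ed d => ‖x‖ ^ (-a)) (bbox r) := by
    intro r hr
    have := integrableOn_ball_of_norm_le_rpow (E := Ed d) (μ := volume) (by simpa using hd)
      (f := fun x : Ed d => ‖x‖ ^ (-a)) (C := 1) (α := a) (r := √d * r + 1)
      (by simpa using had) (ae_of_all _ fun x => by
        rw [Real.norm_of_nonneg (by positivity), one_mul])
      (Measurable.aestronglyMeasurable (by fun_prop))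
    refine this.mono_set fun x hx => ?_
    rw [mem_ball_zero_iff]
    linarith [bbox_norm hr.le hx]
  have hI0 : 0 ≤ I := integral_nonneg fun x => by positivity
  refine ⟨C ^ ((d:ℝ) / 2) * I, by positivity, fun E hE r hr => ?_⟩
  have h1 : ∫ x in bbox r, Gf d (E - V x) ≤
      ∫ x in bbox (d := d) r, C ^ ((d:ℝ) / 2) * ‖x‖ ^ (-a) := by
    refine integral_mono_ae (Gf_int_on hV E (subset_refl _) hr.le)
      ((h_intg r hr).const_mul _) ?_
    filter_upwards [ae_restrict_of_ae (Measure.ae_ne (volume : Measure (Ed d)) 0)] with x hx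
    have hx0 : 0 < ‖x‖ := norm_pos_iff.2 hx
    have hle : E - V x ≤ C * ‖x‖ ^ (-ρ) := by
      have := V_ann hρ hC hbd hx0 le_rfl
      linarith [(abs_le.1 this).1]
    calc Gf d (E - V x) ≤ Gf d (C * ‖x‖ ^ (-ρ)) := Gf_mono d hle
      _ = _ := by
        rw [Gf_mul d hC.le]
        congr 1
        rw [Gf, max_eq_left (by positivity), ← Real.rpow_mul (by positivity), ha]
        congr 1; ring
  refine h1.trans (le_of_eq ?_)
  rw [integral_const_mul]
  have h2 := Measure.setIntegral_comp_smul_of_pos (volume : Measure (Ed d))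
    (fun x : Ed d => ‖x‖ ^ (-a)) (bbox 1) hr
  rw [smul_bbox hr] at h2
  have h3 : ∫ x in bbox (d := d) 1, ‖r • x‖ ^ (-a) = r ^ (-a) * I := by
    rw [hI, ← integral_const_mul]
    congr 1
    ext x
    rw [norm_smul, Real.norm_of_nonneg hr.le, Real.mul_rpow hr.le (norm_nonneg _)]
  rw [h3] at h2
  simp only [finrank_euclideanSpace, Fintype.card_fin, smul_eq_mul] at h2
  rw [eq_inv_mul_iff_mul_eq₀ (by positivity)] at h2
  rw [← h2, ← Lam_eq d ρ hr, ← Real.rpow_mul hr.le]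
  have : -ρ * ((d:ℝ) / 2) = -a := by rw [ha]; ring
  rw [this]; ring

lemma int_upper {d : ℕ} (hd : 1 ≤ d) {ρ : ℝ} (hρ : ρ ∈ Ioo (0:ℝ) 2) {V : Ed d → ℝ}
    (hV : Continuous V) {C : ℝ} (hC : 0 < C) (hbd : ∀ x : Ed d, |V x| ≤ C * (1 + ‖x‖) ^ (-ρ)) :
    ∃ b : ℝ, 0 < b ∧ ∀ L : ℝ, 0 < L →
      ∫ x, Gf d (-L ^ (-ρ) - V x) ≤ b * (L ^ (1 - ρ / 2)) ^ d := by
  obtain ⟨K1, hK1, h⟩ := core_int hd hρ hV hC hbd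
  refine ⟨K1 * ((C ^ (1 / ρ)) ^ (1 - ρ / 2)) ^ d + 1, by positivity, fun L hL => ?_⟩
  rw [Gf_integral_eq hd hρ hC hbd hL le_rfl]
  have hLn : -L ^ (-ρ) ≤ 0 := by have : 0 < L ^ (-ρ) := by positivity
                                 linarith
  refine (h _ hLn _ (by positivity)).trans ?_
  rw [Real.mul_rpow (by positivity) hL.le, mul_pow]
  have : 0 ≤ (L ^ (1 - ρ / 2)) ^ d := by positivity
  nlinarith

lemma int_lower {d : ℕ} (hd : 1 ≤ d) {ρ : ℝ} (hρ : ρ ∈ Ioo (0:ℝ) 2) {V : Ed d → ℝ}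
    (hV : Continuous V) {C C' R : ℝ} (hC : 0 < C) (hC' : 0 < C') (hR : 0 < R)
    (hbd : ∀ x : Ed d, |V x| ≤ C * (1 + ‖x‖) ^ (-ρ))
    (hneg : ∀ x : Ed d, R ≤ ‖x‖ → V x ≤ -C' * ‖x‖ ^ (-ρ)) :
    ∃ a : ℝ, 0 < a ∧ ∃ L0 : ℝ, 0 < L0 ∧ ∀ L : ℝ, L0 ≤ L →
      a * (L ^ (1 - ρ / 2)) ^ d ≤ ∫ x, Gf d (-L ^ (-ρ) - V x) := by
  have hd' : (0:ℝ) < d := by exact_mod_cast hd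
  set y : ℝ := (C' / 2) ^ (1 / ρ) / (2 * √d) with hy
  have hy0 : 0 < y := by positivity
  refine ⟨y ^ d, by positivity, R / y, by positivity, fun L hL => ?_⟩
  have hL0 : 0 < L := lt_of_lt_of_le (by positivity) hL
  have hl : 0 < y * L := by positivity
  have hRl : R ≤ y * L := by rw [div_le_iff₀ hy0] at hL; linarith
  set n : Fin d → ℤ := fun _ => 1 with hn
  have hkey : ∀ x ∈ gcube (y * L) n, L ^ (-ρ) ≤ -L ^ (-ρ) - V x := by
    intro x hx
    have h1 : y * L ≤ ‖x‖ := by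
      apply norm_ge_of_not_bbox
      intro h
      have h1 := h ⟨0, hd⟩
      have h2 := hx ⟨0, hd⟩
      simp only [hn] at h2
      push_cast at h2
      linarith
    have h2 : ‖x‖ ≤ √d * (2 * (y * L)) := by
      apply bbox_norm (by positivity)
      intro i
      have h2 := hx i
      simp only [hn] at h2
      push_cast at h2
      constructor <;> linarith
    have h3 := hneg x (hRl.trans h1)
    have h4 : √d * (2 * (y * L)) = (C' / 2) ^ (1 / ρ) * L := by
      rw [hy]; field_simp
    rw [h4] at h2
    have h5 : 2 / C' * L ^ (-ρ) ≤ ‖x‖ ^ (-ρ) := by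
      have h6 := Real.rpow_le_rpow_of_nonpos (hl.trans_le h1) h2 (by linarith [hρ.1] : -ρ ≤ 0)
      rw [Real.mul_rpow (by positivity) hL0.le, ← Real.rpow_mul (by positivity)] at h6
      have e : 1 / ρ * -ρ = -1 := by have := hρ.1.ne'; field_simp
      rw [e, Real.rpow_neg_one, inv_div] at h6
      exact h6
    have h7 : C' * (2 / C' * L ^ (-ρ)) ≤ C' * ‖x‖ ^ (-ρ) := by gcongr
    have h8 : C' * (2 / C' * L ^ (-ρ)) = 2 * L ^ (-ρ) := by field_simp
    linarith
  have hi := Gf_integrable hd hρ hV hC hbd hL0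
  calc y ^ d * (L ^ (1 - ρ / 2)) ^ d = (y * L) ^ d * Gf d (L ^ (-ρ)) := by
        rw [← Lam_eq d ρ hL0, Gf, max_eq_left (by positivity)]; ring
    _ = ∫ _x in gcube (d := d) (y * L) n, Gf d (L ^ (-ρ)) := (int_gcube_const hl n _).symm
    _ ≤ ∫ x in gcube (d := d) (y * L) n, Gf d (-L ^ (-ρ) - V x) := by
        refine setIntegral_mono_on ?_ hi.integrableOn (measurableSet_gcube _ _)
          fun x hx => Gf_mono d (hkey x hx)
        refine (continuous_const.continuousOn.integrableOn_compact
          (isCompact_closedBall (0 : Ed d) (√d * (2 * (y * L))))).mono_set ?_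
        intro x hx
        rw [mem_closedBall_zero_iff]
        apply bbox_norm (by positivity)
        intro i
        have h2 := hx i
        simp only [hn] at h2
        push_cast at h2
        constructor <;> linarith
    _ ≤ _ := setIntegral_le_integral hi (ae_of_all _ fun x => Gf_nonneg _ _)


/-! ### Comparison on the annulus -/

lemma gcube_subset_bbox {d : ℕ} {l : ℝ} (hl : 0 < l) {m K : ℕ} (hmK : m ≤ K) {n : Fin d → ℤ}
    (hn : n ∈ annIdx d m K) : gcube l n ⊆ bbox (K * l) := by
  rw [bbox_decomp hl hmK]
  intro x hx
  right
  simp only [mem_iUnion]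
  exact ⟨n, hn, hx⟩

lemma int_decomp {d : ℕ} {l : ℝ} (hl : 0 < l) {m K : ℕ} (hmK : m ≤ K) {f : Ed d → ℝ}
    (hf : Integrable f) : ∫ x in bbox (K * l), f x =
      (∫ x in bbox (m * l), f x) + ∑ n ∈ annIdx d m K, ∫ x in gcube l n, f x := by
  rw [bbox_decomp hl hmK, setIntegral_union (bbox_ann_disjoint hl) measurableSet_ann
    hf.integrableOn hf.integrableOn]
  congr 1
  exact integral_biUnion_finset _ (fun n _ => measurableSet_gcube l n)
    (fun n _ n' _ h => gcube_disjoint hl n n' h) (fun n _ => hf.integrableOn)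

lemma cube_cmp {d : ℕ} {l : ℝ} (hl : 0 < l) {n : Fin d → ℤ} {f : Ed d → ℝ}
    (hf : Integrable f) {a e : ℝ} (h : ∀ x ∈ gcube l n, |a - f x| ≤ e) :
    |l ^ d * a - ∫ x in gcube l n, f x| ≤ l ^ d * e := by
  have hi : ∀ c : ℝ, IntegrableOn (fun _ : Ed d => c) (gcube l n) := by
    intro c
    rw [integrableOn_const_iff]
    right
    refine lt_of_le_of_lt (measure_mono (t := Metric.closedBall (aff l n 0) (√d * l)) ?_)
      measure_closedBall_lt_top
    intro x hx
    rw [mem_closedBall_iff_norm]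
    exact gcube_norm_sub hl hx (gcube_zero_mem hl n)
  have h1 : ∫ x in gcube l n, f x ≤ ∫ _x in gcube (d := d) l n, (a + e) :=
    setIntegral_mono_on hf.integrableOn (hi _) (measurableSet_gcube _ _) fun x hx => by
      linarith [(abs_le.1 (h x hx)).1]
  have h2 : ∫ _x in gcube (d := d) l n, (a - e) ≤ ∫ x in gcube l n, f x :=
    setIntegral_mono_on (hi _) hf.integrableOn (measurableSet_gcube _ _) fun x hx => by
      linarith [(abs_le.1 (h x hx)).2]
  rw [int_gcube_const hl] at h1 h2
  rw [abs_le]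
  constructor <;> nlinarith

lemma ann_cmp {d : ℕ} {ρ : ℝ} (hρ : ρ ∈ Ioo (0:ℝ) 2) {V : Ed d → ℝ} (hV : ContDiff ℝ 1 V)
    {C : ℝ} (hC : 0 < C) (hbd : ∀ x : Ed d, |V x| ≤ C * (1 + ‖x‖) ^ (-ρ))
    (hgrad : ∀ x : Ed d, ‖gradient V x‖ ≤ C * (1 + ‖x‖) ^ (-ρ - 1))
    {s : ℝ} (hs : 0 < s) {m K : ℕ} (hm : 0 < m) {η' δ : ℝ}
    (hδ : ∀ u t : ℝ, |u| ≤ C * s ^ (-ρ) + 1 → |u - t| ≤ δ → |Gf d u - Gf d t| ≤ η')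
    (hmδ : 2 * (C * √d * s ^ (-ρ) / m) ≤ δ) {L l : ℝ} (hL : 0 < L) (hl : 0 < l)
    (hml : m * l = s * L) (hf : Integrable (fun x => Gf d (-L ^ (-ρ) - V x)))
    {n : Fin d → ℤ} (hn : n ∈ annIdx d m K) {c : ℝ}
    (hc : |c - (-L ^ (-ρ) - V (aff l n 0))| ≤ C * √d * (m * l) ^ (-ρ) / m) :
    |l ^ d * Gf d c - ∫ x in gcube l n, Gf d (-L ^ (-ρ) - V x)| ≤
      l ^ d * ((L ^ (-ρ)) ^ ((d:ℝ) / 2) * η') := by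
  apply cube_cmp hl hf
  intro x hx
  have he : 0 < L ^ (-ρ) := by positivity
  set ε := L ^ (-ρ) with hε
  have hsL : (m * l) ^ (-ρ) = s ^ (-ρ) * ε := by rw [hml, Real.mul_rpow hs.le hL.le]
  have h1 := osc_V hρ hV hC hgrad hl hm hn hx (gcube_zero_mem hl n)
  have h2 : |V x| ≤ C * (m * l) ^ (-ρ) :=
    V_ann hρ hC hbd (by positivity) (norm_ge_of_ann hl hn hx)
  rw [hsL] at h1 h2 hc
  have e1 : Gf d c = ε ^ ((d:ℝ) / 2) * Gf d (c / ε) := by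
    rw [← Gf_mul d he.le]; congr 1; field_simp
  have e2 : Gf d (-ε - V x) = ε ^ ((d:ℝ) / 2) * Gf d ((-ε - V x) / ε) := by
    rw [← Gf_mul d he.le]; congr 1; field_simp
  rw [e1, e2, ← mul_sub, abs_mul, abs_of_nonneg (by positivity : 0 ≤ ε ^ ((d:ℝ) / 2))]
  gcongr
  rw [abs_sub_comm]
  apply hδ
  · rw [abs_div, abs_of_pos he, div_le_iff₀ he]
    rw [abs_le] at h2 ⊢
    constructor <;> nlinarith
  · refine le_trans ?_ hmδ
    rw [← sub_div, abs_div, abs_of_pos he, div_le_iff₀ he]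
    have e3 : 2 * (C * √d * s ^ (-ρ) / m) * ε =
      C * √d * (s ^ (-ρ) * ε) / m + C * √d * (s ^ (-ρ) * ε) / m := by ring
    rw [e3]
    rw [abs_le] at h1 hc ⊢
    constructor <;> linarith

lemma est_fixed {d : ℕ} (hd : 1 ≤ d) {ρ : ℝ} (hρ : ρ ∈ Ioo (0:ℝ) 2) {V : Ed d → ℝ}
    (hV : ContDiff ℝ 1 V)
    {C : ℝ} (hC : 0 < C) (hbd : ∀ x : Ed d, |V x| ≤ C * (1 + ‖x‖) ^ (-ρ))
    (hgrad : ∀ x : Ed d, ‖gradient V x‖ ≤ C * (1 + ‖x‖) ^ (-ρ - 1))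
    {K0 K1 b η η' δ A : ℝ} (hK1 : 0 ≤ K1) (hη : 0 < η) (hη' : 0 < η')
    (hA : 0 ≤ A) (hK00 : 0 < K0)
    (hK0 : ∀ W : Ed d → ℝ, Continuous W →
      (∀ x, - (C * (1 + ‖x‖) ^ (-ρ)) ≤ W x) → ∀ r : ℝ, 1 ≤ r →
      Good (bbox r) W (K0 * (r ^ (1 - ρ / 2)) ^ d))
    (hK1' : ∀ E ≤ 0, ∀ r : ℝ, 0 < r →
      ∫ x in bbox r, Gf d (E - V x) ≤ K1 * (r ^ (1 - ρ / 2)) ^ d)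
    (hb : ∀ L : ℝ, 0 < L → ∫ x, Gf d (-L ^ (-ρ) - V x) ≤ b * (L ^ (1 - ρ / 2)) ^ d)
    (hA0 : ∀ l : ℝ, 0 < l → ∀ c : ℝ,
      (cnt0 d (l ^ 2 * c) : ℝ) ≤ (kap d + η) * (l ^ d * Gf d c) + A)
    (hA1 : ∀ l : ℝ, 0 < l → ∀ c : ℝ,
      (kap d - η) * (l ^ d * Gf d c) - A ≤ (cnt1 d (l ^ 2 * c) : ℝ))
    {s : ℝ} (hs : 0 < s) (hs1 : s ≤ 1) {m K : ℕ} (hm : 0 < m)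
    (hδ : ∀ u t : ℝ, |u| ≤ C * s ^ (-ρ) + 1 → |u - t| ≤ δ → |Gf d u - Gf d t| ≤ η')
    (hmδ : 2 * (C * √d * s ^ (-ρ) / m) ≤ δ)
    (hK : K = m + ⌈m * C ^ (1 / ρ) / s⌉₊) {L : ℝ} (hL : 0 < L) (hsL : 1 ≤ s * L) :
    schN d V (-L ^ (-ρ)) ≠ ⊤ ∧
    |((schN d V (-L ^ (-ρ))).toNat : ℝ) - kap d * ∫ x, Gf d (-L ^ (-ρ) - V x)| ≤
      (L ^ (1 - ρ / 2)) ^ d * ((K0 + kap d * K1) * (s ^ (1 - ρ / 2)) ^ d +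
        (kap d + η) * ((2 * (2 + C ^ (1 / ρ))) ^ d * η') + η * b) + A * (2 * K) ^ d := by
  have hmR : (0:ℝ) < m := by exact_mod_cast hm
  have hm1 : (1:ℝ) ≤ m := by exact_mod_cast hm
  set E : ℝ := -L ^ (-ρ) with hE
  have he : 0 < L ^ (-ρ) := by positivity
  have hE0 : E ≤ 0 := by rw [hE]; linarith
  set l : ℝ := s * L / m with hl'
  have hl : 0 < l := by positivity
  have hml : m * l = s * L := by rw [hl']; field_simp
  have hmK : m ≤ K := by omega
  have hVc : Continuous V := hV.continuous
  have hWc : Continuous fun x => V x - E := by fun_prop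
  have hf : Integrable (fun x => Gf d (E - V x)) := Gf_integrable hd hρ hVc hC hbd hL
  have hKlow : C ^ (1 / ρ) * L ≤ K * l := by
    have h1 : m * C ^ (1 / ρ) / s ≤ K := by
      rw [hK]; push_cast
      linarith [Nat.le_ceil (m * C ^ (1 / ρ) / s)]
    calc C ^ (1 / ρ) * L = m * C ^ (1 / ρ) / s * l := by rw [hl']; field_simp
      _ ≤ _ := by gcongr
  have hKup : K * l ≤ (2 + C ^ (1 / ρ)) * L := by
    have h1 : (K:ℝ) ≤ m + (m * C ^ (1 / ρ) / s + 1) := by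
      rw [hK]; push_cast
      linarith [Nat.ceil_lt_add_one (by positivity : 0 ≤ m * C ^ (1 / ρ) / s)]
    calc K * l ≤ (m + (m * C ^ (1 / ρ) / s + 1)) * l := by gcongr
      _ = m * l + C ^ (1 / ρ) * L + l := by
        rw [hl']; field_simp; ring
      _ ≤ _ := by
        have h2 : l ≤ m * l := by nlinarith
        nlinarith
  set ω : ℝ := C * √d * (m * l) ^ (-ρ) / m with hω
  have hω0 : 0 ≤ ω := by positivity
  set Lam : ℝ := (L ^ (1 - ρ / 2)) ^ d with hLam
  have hLam0 : 0 < Lam := by positivity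
  set D : ℝ := (2 * (2 + C ^ (1 / ρ))) ^ d with hD
  set Q := annIdx d m K with hQ
  set J : ℝ := ∑ n ∈ Q, ∫ x in gcube l n, Gf d (E - V x) with hJ
  set I : ℝ := ∫ x, Gf d (E - V x) with hI
  set cc : ℝ := ∫ x in bbox (m * l), Gf d (E - V x) with hcc
  have hIJ : I = cc + J := by
    rw [hI, hE, Gf_integral_eq hd hρ hC hbd hL hKlow]
    exact int_decomp hl hmK hf
  have hcc0 : 0 ≤ cc := integral_nonneg fun x => Gf_nonneg _ _
  have hrp : ((s * L) ^ (1 - ρ / 2)) ^ d = (s ^ (1 - ρ / 2)) ^ d * Lam := by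
    rw [Real.mul_rpow hs.le hL.le, mul_pow]
  have hcc1 : cc ≤ K1 * ((s ^ (1 - ρ / 2)) ^ d * Lam) := by
    rw [← hrp, ← hml]
    exact hK1' E hE0 _ (by positivity)
  have hcard : (Q.card : ℝ) ≤ (2 * K) ^ d := by exact_mod_cast annIdx_card_le d m K
  have hI1 : I ≤ b * Lam := hb L hL
  -- sums with perturbed constants
  have hsum : ∀ c : (Fin d → ℤ) → ℝ, (∀ n ∈ Q, |c n - (E - V (aff l n 0))| ≤ ω) →
      |∑ n ∈ Q, l ^ d * Gf d (c n) - J| ≤ D * η' * Lam := by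
    intro c hc
    rw [hJ, ← Finset.sum_sub_distrib]
    refine (Finset.abs_sum_le_sum_abs _ _).trans ?_
    calc ∑ n ∈ Q, |l ^ d * Gf d (c n) - ∫ x in gcube l n, Gf d (E - V x)|
        ≤ ∑ _n ∈ Q, l ^ d * ((L ^ (-ρ)) ^ ((d:ℝ) / 2) * η') :=
          Finset.sum_le_sum fun n hn =>
            ann_cmp hρ hV hC hbd hgrad hs hm hδ hmδ hL hl hml hf hn (hc n hn)
      _ = Q.card * (l ^ d * ((L ^ (-ρ)) ^ ((d:ℝ) / 2) * η')) := by
          rw [Finset.sum_const, nsmul_eq_mul]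
      _ ≤ (2 * K) ^ d * (l ^ d * ((L ^ (-ρ)) ^ ((d:ℝ) / 2) * η')) := by gcongr
      _ = (2 * (K * l)) ^ d * ((L ^ (-ρ)) ^ ((d:ℝ) / 2) * η') := by
          rw [← mul_assoc, ← mul_pow]; ring
      _ ≤ (2 * ((2 + C ^ (1 / ρ)) * L)) ^ d * ((L ^ (-ρ)) ^ ((d:ℝ) / 2) * η') := by gcongr
      _ = D * η' * Lam := by
          rw [hLam, ← Lam_eq d ρ hL, hD, ← mul_assoc 2, mul_pow _ L]; ring
  -- upper bound
  have hup : Good (univ : Set (Ed d)) (fun x => V x - E)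
      (K0 * ((s ^ (1 - ρ / 2)) ^ d * Lam) +
        ∑ n ∈ Q, (cnt0 d (l ^ 2 * (E - V (aff l n 0) + ω)) : ℝ)) := by
    have h0 : Good (bbox (m * l)) (fun x => V x - E) (K0 * ((s ^ (1 - ρ / 2)) ^ d * Lam)) := by
      rw [← hrp, hml]
      refine hK0 _ hWc (fun x => ?_) _ hsL
      linarith [(abs_le.1 (hbd x)).1]
    have h1 := good_ann hl hmK hWc h0 (fun n => E - V (aff l n 0) + ω) (by
      intro n hn x hx
      have := osc_V hρ hV hC hgrad hl hm hn hx (gcube_zero_mem hl n)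
      have := (abs_le.1 this).1
      linarith)
    have h2 : Good (bbox (d := d) (K * l))ᶜ (fun x => V x - E) 0 := by
      refine good_nonneg (measurableSet_bbox _).compl fun x hx => ?_
      have := V_out hρ hC hbd hL (hKlow.trans (norm_ge_of_not_bbox x hx))
      linarith
    have h3 := good_union hWc disjoint_compl_right (measurableSet_bbox _).compl h1 h2
    rw [union_compl_self, add_zero] at h3
    exact h3
  obtain ⟨hne, hN⟩ := schN_le hVc hup
  refine ⟨hne, ?_⟩
  set N : ℝ := ((schN d V E).toNat : ℝ) with hNdef
  have hκ := kap_nonneg d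
  have hD0 : 0 ≤ D := by positivity
  have hS1 := hsum (fun n => E - V (aff l n 0) + ω) (fun n _ => by
    rw [add_sub_cancel_left, abs_of_nonneg hω0])
  have hS2 := hsum (fun n => E - (V (aff l n 0) + ω)) (fun n _ => by
    rw [sub_add_eq_sub_sub, sub_sub_cancel_left, abs_neg, abs_of_nonneg hω0])
  set S1 := ∑ n ∈ Q, l ^ d * Gf d (E - V (aff l n 0) + ω) with hS1d
  set S2 := ∑ n ∈ Q, l ^ d * Gf d (E - (V (aff l n 0) + ω)) with hS2d
  have hU : ∑ n ∈ Q, (cnt0 d (l ^ 2 * (E - V (aff l n 0) + ω)) : ℝ) ≤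
      (kap d + η) * S1 + A * (2 * K) ^ d := by
    calc _ ≤ ∑ n ∈ Q, ((kap d + η) * (l ^ d * Gf d (E - V (aff l n 0) + ω)) + A) :=
          Finset.sum_le_sum fun n _ => hA0 l hl _
      _ = (kap d + η) * S1 + Q.card * A := by
          rw [Finset.sum_add_distrib, ← Finset.mul_sum, Finset.sum_const, nsmul_eq_mul]
      _ ≤ _ := by
          rw [mul_comm A]; gcongr
  have hLo : (kap d - η) * S2 - A * (2 * K) ^ d ≤ N := by
    have h1 := schN_ge hl hVc E Q (fun n => V (aff l n 0) + ω) (by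
      intro n hn x hx
      have := osc_V hρ hV hC hgrad hl hm hn hx (gcube_zero_mem hl n)
      have := (abs_le.1 this).2
      linarith)
    have h2 : (∑ n ∈ Q, cnt1 d (l ^ 2 * (E - (V (aff l n 0) + ω)))) ≤ (schN d V E).toNat := by
      rw [← ENat.natCast_toNat hne] at h1
      exact_mod_cast h1
    have h3 : (∑ n ∈ Q, (cnt1 d (l ^ 2 * (E - (V (aff l n 0) + ω))) : ℝ)) ≤ N := by
      rw [hNdef]; exact_mod_cast h2
    refine le_trans ?_ h3
    calc (kap d - η) * S2 - A * (2 * K) ^ d ≤ (kap d - η) * S2 - Q.card * A := by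
          rw [mul_comm A]; gcongr
      _ = ∑ n ∈ Q, ((kap d - η) * (l ^ d * Gf d (E - (V (aff l n 0) + ω))) - A) := by
          rw [Finset.sum_sub_distrib, ← Finset.mul_sum, Finset.sum_const, nsmul_eq_mul]
      _ ≤ _ := Finset.sum_le_sum fun n _ => hA1 l hl _
  rw [abs_le] at hS1 hS2
  have a1 : (kap d + η) * S1 ≤ (kap d + η) * (J + D * η' * Lam) := by
    gcongr; linarith
  have a2 : η * J ≤ η * (b * Lam) := by gcongr; linarith
  have a3 : kap d * J ≤ kap d * I := by gcongr; linarith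
  have a4 : kap d * (J - D * η' * Lam) ≤ kap d * S2 := by gcongr; linarith
  have a5 : η * S2 ≤ η * (J + D * η' * Lam) := by gcongr; linarith
  have a6 : kap d * cc ≤ kap d * (K1 * ((s ^ (1 - ρ / 2)) ^ d * Lam)) := by gcongr
  have p0 : 0 ≤ K0 * ((s ^ (1 - ρ / 2)) ^ d * Lam) := by positivity
  have p1 : 0 ≤ kap d * (K1 * ((s ^ (1 - ρ / 2)) ^ d * Lam)) := by positivity
  have a7 : kap d * I = kap d * cc + kap d * J := by rw [hIJ]; ring
  rw [abs_le]
  constructor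
  · linarith
  · linarith


/-! ### Conclusion -/

lemma kap_pos (d : ℕ) : 0 < kap d := by
  unfold kap tau
  refine div_pos (ENNReal.toReal_pos ?_ ?_) (by positivity)
  · exact (Metric.measure_ball_pos _ _ one_pos).ne'
  · exact measure_ball_lt_top.ne

lemma main_est {d : ℕ} (hd : 1 ≤ d) {ρ : ℝ} (hρ : ρ ∈ Ioo (0:ℝ) 2) {V : Ed d → ℝ}
    (hV : ContDiff ℝ 1 V)
    {C : ℝ} (hC : 0 < C) (hbd : ∀ x : Ed d, |V x| ≤ C * (1 + ‖x‖) ^ (-ρ))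
    (hgrad : ∀ x : Ed d, ‖gradient V x‖ ≤ C * (1 + ‖x‖) ^ (-ρ - 1)) {θ : ℝ} (hθ : 0 < θ) :
    ∃ L0 : ℝ, 0 < L0 ∧ ∀ L : ℝ, L0 ≤ L → schN d V (-L ^ (-ρ)) ≠ ⊤ ∧
    |((schN d V (-L ^ (-ρ))).toNat : ℝ) - kap d * ∫ x, Gf d (-L ^ (-ρ) - V x)| ≤
      θ * (L ^ (1 - ρ / 2)) ^ d := by
  obtain ⟨K0, hK00, hK0⟩ := good_core hd hρ hC
  obtain ⟨K1, hK1, hK1'⟩ := core_int hd hρ hV.continuous hC hbd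
  obtain ⟨b, hb0, hb⟩ := int_upper hd hρ hV.continuous hC hbd
  have hκ := kap_pos d
  have hσ : 0 < 1 - ρ / 2 := by linarith [hρ.2]
  set σ : ℝ := 1 - ρ / 2 with hσd
  set η : ℝ := min 1 (θ / (4 * b)) with hη
  have hη0 : 0 < η := by positivity
  have hηb : η * b ≤ θ / 4 := by
    calc η * b ≤ θ / (4 * b) * b := by gcongr; exact min_le_right _ _
      _ = θ / 4 := by field_simp
  obtain ⟨A0, hA00, hA0⟩ := cnt0_bd d hη0
  obtain ⟨A1, hA10, hA1⟩ := cnt1_bd d hη0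
  set D : ℝ := (2 * (2 + C ^ (1 / ρ))) ^ d with hD
  have hD0 : 0 < D := by positivity
  set η' : ℝ := θ / (4 * ((kap d + 1) * D)) with hη'
  have hη'0 : 0 < η' := by positivity
  have hη'b : (kap d + η) * (D * η') ≤ θ / 4 := by
    calc (kap d + η) * (D * η') ≤ (kap d + 1) * (D * η') := by
          gcongr; exact min_le_left _ _
      _ = θ / 4 := by rw [hη']; field_simp
  set q : ℝ := θ / (4 * (K0 + kap d * K1)) with hq
  have hq0 : 0 < q := by positivity
  set s : ℝ := min 1 (q ^ (1 / σ)) with hs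
  have hs0 : 0 < s := by positivity
  have hs1 : s ≤ 1 := min_le_left _ _
  have hsq : (s ^ σ) ^ d ≤ q := by
    have h1 : s ^ σ ≤ 1 := Real.rpow_le_one hs0.le hs1 hσ.le
    have h2 : s ^ σ ≤ q := by
      calc s ^ σ ≤ (q ^ (1 / σ)) ^ σ := by gcongr; exact min_le_right _ _
        _ = q := by rw [← Real.rpow_mul hq0.le, one_div_mul_cancel hσ.ne', Real.rpow_one]
    exact (pow_le_of_le_one (by positivity) h1 (by omega)).trans h2
  have hsb : (K0 + kap d * K1) * (s ^ σ) ^ d ≤ θ / 4 := by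
    calc (K0 + kap d * K1) * (s ^ σ) ^ d ≤ (K0 + kap d * K1) * q := by gcongr
      _ = θ / 4 := by rw [hq]; field_simp
  obtain ⟨δ, hδ0, hδ⟩ := Gf_unif d (C * s ^ (-ρ) + 1) hη'0
  set m : ℕ := ⌈2 * (C * √d * s ^ (-ρ)) / δ⌉₊ + 1 with hm
  have hm0 : 0 < m := by omega
  have hmδ : 2 * (C * √d * s ^ (-ρ) / m) ≤ δ := by
    have h1 : 2 * (C * √d * s ^ (-ρ)) / δ ≤ m := by
      rw [hm]; push_cast
      linarith [Nat.le_ceil (2 * (C * √d * s ^ (-ρ)) / δ)]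
    have hmR : (0:ℝ) < m := by exact_mod_cast hm0
    rw [← mul_div_assoc, div_le_iff₀ hmR]
    rw [div_le_iff₀ hδ0] at h1
    linarith
  set K : ℕ := m + ⌈m * C ^ (1 / ρ) / s⌉₊ with hK
  set A : ℝ := max A0 A1 with hA
  have hAnn : 0 ≤ A := le_max_of_le_left hA00
  set X : ℝ := A * (2 * K) ^ d * 4 / θ + 1 with hX
  have hX0 : 0 < X := by positivity
  refine ⟨max (1 / s) (max 1 (X ^ (1 / σ))), by positivity, fun L hL => ?_⟩
  have hL1 : 1 / s ≤ L := (le_max_left _ _).trans hL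
  have hL2 : 1 ≤ L := ((le_max_left _ _).trans (le_max_right _ _)).trans hL
  have hL3 : X ^ (1 / σ) ≤ L := ((le_max_right _ _).trans (le_max_right _ _)).trans hL
  have hL0 : 0 < L := by linarith
  have hsL : 1 ≤ s * L := by rw [div_le_iff₀ hs0] at hL1; linarith
  obtain ⟨h1, h2⟩ := est_fixed hd hρ hV hC hbd hgrad hK1 hη0 hη'0 hAnn hK00 hK0 hK1' hb
    (fun l hl c => (hA0 l hl c).trans (by gcongr; exact le_max_left _ _))
    (fun l hl c => le_trans (by gcongr; exact le_max_right _ _) (hA1 l hl c))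
    hs0 hs1 hm0 hδ hmδ hK hL0 hsL
  refine ⟨h1, h2.trans ?_⟩
  have h3 : X ≤ (L ^ σ) ^ d := by
    have h4 : X ≤ L ^ σ := by
      calc X = (X ^ (1 / σ)) ^ σ := by
            rw [← Real.rpow_mul hX0.le, one_div_mul_cancel hσ.ne', Real.rpow_one]
        _ ≤ L ^ σ := by gcongr
    have h5 : 1 ≤ L ^ σ := Real.one_le_rpow hL2 hσ.le
    exact h4.trans (le_self_pow₀ h5 (by omega))
  have h6 : A * (2 * K) ^ d ≤ θ / 4 * (L ^ σ) ^ d := by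
    calc A * (2 * K) ^ d ≤ θ / 4 * X := by
          rw [hX]; field_simp; linarith
      _ ≤ _ := by gcongr
  have h7 : (L ^ σ) ^ d * ((K0 + kap d * K1) * (s ^ σ) ^ d + (kap d + η) * (D * η') + η * b) ≤
      (L ^ σ) ^ d * (θ / 4 + θ / 4 + θ / 4) := by gcongr
  linarith

lemma E_conv {d : ℕ} {ρ : ℝ} (hρ : ρ ∈ Ioo (0:ℝ) 2) {L0 : ℝ} (hL0 : 0 < L0) {E : ℝ}
    (hE : E ∈ Ioo (-L0 ^ (-ρ)) 0) : ∃ L : ℝ, L0 ≤ L ∧ -L ^ (-ρ) = E ∧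
      (L ^ (1 - ρ / 2)) ^ d = |E| ^ ((d : ℝ) * (1 / 2 - 1 / ρ)) := by
  have hρ0 := hρ.1
  have hE0 : 0 < -E := by linarith [hE.2]
  refine ⟨(-E) ^ (-(1 / ρ)), ?_, ?_, ?_⟩
  · have h1 : -E ≤ L0 ^ (-ρ) := by linarith [hE.1]
    have h2 := Real.rpow_le_rpow_of_nonpos hE0 h1 (by
      have : 0 < 1 / ρ := by positivity
      linarith : -(1 / ρ) ≤ 0)
    rw [← Real.rpow_mul hL0.le] at h2
    have e : -ρ * -(1 / ρ) = 1 := by field_simp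
    rwa [e, Real.rpow_one] at h2
  · rw [← Real.rpow_mul hE0.le]
    have e : -(1 / ρ) * -ρ = 1 := by field_simp
    rw [e, Real.rpow_one, neg_neg]
  · rw [← Real.rpow_mul hE0.le, ← Real.rpow_natCast, ← Real.rpow_mul hE0.le,
      abs_of_neg hE.2]
    congr 1
    field_simp
    ring

/-- Proposition 2.2: semiclassical eigenvalue asymptotics for a regularly decaying
negative potential, `ρ ∈ (0,2)`. -/
theorem semiclassical_eigenvalue_asymptotics
    (d : ℕ) (hd : 1 ≤ d) (ρ : ℝ) (hρ : ρ ∈ Set.Ioo (0 : ℝ) 2)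
    (V : Ed d → ℝ) (hV : ContDiff ℝ 1 V)
    (C C' R : ℝ) (hC : 0 < C) (hC' : 0 < C') (hR : 0 < R)
    (hbd : ∀ x : Ed d, |V x| ≤ C * (1 + ‖x‖) ^ (-ρ))
    (hgrad : ∀ x : Ed d, ‖gradient V x‖ ≤ C * (1 + ‖x‖) ^ (-ρ - 1))
    (hneg : ∀ x : Ed d, R ≤ ‖x‖ → V x ≤ -C' * ‖x‖ ^ (-ρ)) :
    Tendsto (fun E : ℝ => ((schN d V E).toNat : ℝ) / Ncl d V E) (𝓝[<] 0) (𝓝 1) ∧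
    ∃ c₁ c₂ : ℝ, 0 < c₁ ∧ 0 < c₂ ∧ ∃ E₀ : ℝ, E₀ < 0 ∧ ∀ E ∈ Set.Ioo E₀ (0 : ℝ),
      schN d V E ≠ ⊤ ∧
      c₁ * |E| ^ ((d : ℝ) * (1 / 2 - 1 / ρ)) ≤ ((schN d V E).toNat : ℝ) ∧
      ((schN d V E).toNat : ℝ) ≤ c₂ * |E| ^ ((d : ℝ) * (1 / 2 - 1 / ρ)) := by
  obtain ⟨b, hb0, hb⟩ := int_upper hd hρ hV.continuous hC hbd
  obtain ⟨a, ha0, L1, hL1, ha⟩ := int_lower hd hρ hV.continuous hC hC' hR hbd hneg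
  have hκ := kap_pos d
  constructor
  · rw [Metric.tendsto_nhds]
    intro ε hε
    obtain ⟨L0, hL0, h⟩ := main_est hd hρ hV hC hbd hgrad
      (by positivity : 0 < ε * (kap d * a) / 2)
    have hM : 0 < max L0 L1 := lt_max_of_lt_left hL0
    have hneg0 : -(max L0 L1) ^ (-ρ) < 0 := by
      have : 0 < (max L0 L1) ^ (-ρ) := by positivity
      linarith
    filter_upwards [Ioo_mem_nhdsLT hneg0] with E hE
    obtain ⟨L, hLL, hLE, -⟩ := E_conv (d := d) hρ hM hE
    have hLpos : 0 < L := hM.trans_le hLL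
    obtain ⟨-, h2⟩ := h L ((le_max_left _ _).trans hLL)
    have h3 := ha L ((le_max_right _ _).trans hLL)
    rw [hLE] at h2 h3
    change _ ≤ _ at h2
    have hN : Ncl d V E = kap d * ∫ x, Gf d (E - V x) := rfl
    rw [← hN] at h2
    have hΛ : 0 < (L ^ (1 - ρ / 2)) ^ d := by positivity
    have h4 : kap d * (a * (L ^ (1 - ρ / 2)) ^ d) ≤ Ncl d V E := by
      rw [hN]; gcongr
    have h5 : 0 < Ncl d V E := lt_of_lt_of_le (by positivity) h4
    rw [Real.dist_eq, div_sub_one h5.ne', abs_div, abs_of_pos h5, div_lt_iff₀ h5]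
    have h6 : 0 < ε * (kap d * (a * (L ^ (1 - ρ / 2)) ^ d)) := by positivity
    have h7 : ε * (kap d * (a * (L ^ (1 - ρ / 2)) ^ d)) ≤ ε * Ncl d V E := by gcongr
    nlinarith
  · obtain ⟨L0, hL0, h⟩ := main_est hd hρ hV hC hbd hgrad (by positivity : 0 < kap d * a / 2)
    have hM : 0 < max L0 L1 := lt_max_of_lt_left hL0
    refine ⟨kap d * a / 2, kap d * b + kap d * a / 2, by positivity, by positivity,
      -(max L0 L1) ^ (-ρ), ?_, fun E hE => ?_⟩
    · have : 0 < (max L0 L1) ^ (-ρ) := by positivity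
      linarith
    obtain ⟨L, hLL, hLE, hΛE⟩ := E_conv (d := d) hρ hM hE
    have hLpos : 0 < L := hM.trans_le hLL
    obtain ⟨h1, h2⟩ := h L ((le_max_left _ _).trans hLL)
    have h3 := ha L ((le_max_right _ _).trans hLL)
    have h4 := hb L hLpos
    rw [hLE] at h1 h2 h3 h4
    refine ⟨h1, ?_⟩
    rw [← hΛE]
    have h5 := mul_le_mul_of_nonneg_left h3 hκ.le
    have h6 := mul_le_mul_of_nonneg_left h4 hκ.le
    rw [abs_le] at h2
    constructor <;> linarith

end
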